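/- arXiv:2402.08160 — 3 statements merged into one kernel-verified Lean document; each statement's English description precedes it below -/
import Mathlib

section
/- Let s ≥ 2 be an integer and p a prime with p > 2s + 1. Then in ℤ/pℤ: t_p(s,s) = ζ^{(2)}_p(s,s) = (1 − 2^{1−s})^2 · B_{p−s}^2 / (2 s^2), where 2^{1−s} denotes the inverse of 2^{s−1} in ℤ/pℤ and B_{p−s} is the (p−s)-th Bernoulli number reduced mod p. -/
open Finset

/-- `t_p(s) ∈ ℤ/pℤ`: the sum over integers `p > n_1 > … > n_d > 0` with all `n_j`
odd, of `∏_j n_j^{-s_j}`, inverses taken in `ℤ/pℤ`. -/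
def tp (p d : ℕ) (s : Fin d → ℕ) : ZMod p :=
  ∑ m ∈ univ.filter (fun m : Fin d → Fin p =>
      (∀ i j : Fin d, i < j → (m j : ℕ) < (m i : ℕ)) ∧
      (∀ j, 0 < (m j : ℕ)) ∧
      (∀ j, (m j : ℕ) % 2 = 1)),
    ∏ j, (((m j : ℕ) : ZMod p))⁻¹ ^ (s j)

/-- `ζ^{(2)}_p(s) ∈ ℤ/pℤ`: the sum over integers `p > n_1 > … > n_d > 0` with all
`n_j` even, of `∏_j n_j^{-s_j}`, inverses taken in `ℤ/pℤ`. -/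
def zeta2p (p d : ℕ) (s : Fin d → ℕ) : ZMod p :=
  ∑ m ∈ univ.filter (fun m : Fin d → Fin p =>
      (∀ i j : Fin d, i < j → (m j : ℕ) < (m i : ℕ)) ∧
      (∀ j, 0 < (m j : ℕ)) ∧
      (∀ j, (m j : ℕ) % 2 = 0)),
    ∏ j, (((m j : ℕ) : ZMod p))⁻¹ ^ (s j)

/-- The rationals whose denominator is nonzero in `K`. -/
def ratCastSubring (K : Type*) [Field K] : Subring ℚ where
  carrier := {q | (q.den : K) ≠ 0}
  zero_mem' := by simp
  one_mem' := by simp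
  add_mem' {a b} ha hb h := by
    obtain ⟨c, hc⟩ := Rat.add_den_dvd a b
    exact mul_ne_zero ha hb (by rw [← Nat.cast_mul, hc, Nat.cast_mul, h, zero_mul])
  mul_mem' {a b} ha hb h := by
    obtain ⟨c, hc⟩ := Rat.mul_den_dvd a b
    exact mul_ne_zero ha hb (by rw [← Nat.cast_mul, hc, Nat.cast_mul, h, zero_mul])
  neg_mem' {a} ha := by simpa using ha

/-- The canonical cast, as a ring homomorphism on `ratCastSubring K`. -/
def ratCastSubringHom (K : Type*) [Field K] : ratCastSubring K →+* K where
  toFun q := ((q : ℚ) : K)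
  map_zero' := by simp
  map_one' := by simp
  map_add' a b := Rat.cast_add_of_ne_zero a.2 b.2
  map_mul' a b := Rat.cast_mul_of_ne_zero a.2 b.2

theorem inv_natCast_mem_ratCastSubring {K : Type*} [Field K] {n : ℕ} (hn : (n : K) ≠ 0) :
    ((n : ℚ)⁻¹) ∈ ratCastSubring K := by
  have h0 : n ≠ 0 := by rintro rfl; simp at hn
  change (((n : ℚ)⁻¹).den : K) ≠ 0
  simpa [Rat.inv_natCast_den, h0] using hn

theorem natCast_ne_zero_of_lt {p n : ℕ} (h0 : 0 < n) (h : n < p) : (n : ZMod p) ≠ 0 := by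
  rw [Ne, ZMod.natCast_eq_zero_iff]
  exact Nat.not_dvd_of_pos_of_lt h0 h

/-- `B_n` is `p`-integral for `n < p - 1`. -/
theorem bernoulli_mem_ratCastSubring {p : ℕ} [Fact p.Prime] {n : ℕ} (hn : n + 1 < p) :
    bernoulli n ∈ ratCastSubring (ZMod p) := by
  induction n using Nat.strong_induction_on with
  | _ n ih =>
    have h := sum_bernoulli (n + 1)
    rw [sum_range_succ] at h
    have hn0 : ((n + 1 : ℕ) : ℚ) ≠ 0 := by positivity
    have hB : bernoulli n = ((n + 1 : ℕ) : ℚ)⁻¹ *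
        ((if n + 1 = 1 then 1 else 0) -
          ∑ k ∈ range n, ((n + 1).choose k : ℚ) * bernoulli k) := by
      rw [← h, Nat.choose_succ_self_right]
      field_simp
      ring
    rw [hB]
    refine mul_mem (inv_natCast_mem_ratCastSubring (natCast_ne_zero_of_lt n.succ_pos hn))
      (sub_mem ?_ (sum_mem fun k hk => mul_mem (natCast_mem _ _) (ih k ?_ ?_)))
    · split_ifs
      exacts [one_mem _, zero_mem _]
    · exact mem_range.1 hk
    · have := mem_range.1 hk
      omega

/-- A rational polynomial with period `1 / 2` is constant. -/
theorem derivative_eq_zero_of_eval_add_half (f : Polynomial ℚ)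
    (h : ∀ x : ℚ, f.eval (x + 1 / 2) = f.eval x) : f.derivative = 0 := by
  have hn : ∀ n : ℕ, f.eval ((n : ℚ) / 2) = f.eval 0 := by
    intro n
    induction n with
    | zero => simp
    | succ n ih => rw [← ih, ← h (n / 2), Nat.cast_succ, add_div]
  have hc : f = Polynomial.C (f.eval 0) := by
    refine Polynomial.eq_of_infinite_eval_eq _ _
      ((Set.infinite_range_of_injective (f := fun n : ℕ => (n : ℚ) / 2) ?_).mono ?_)
    · intro a b hab
      simpa using hab
    · rintro _ ⟨n, rfl⟩
      simp [hn]
  rw [hc, Polynomial.derivative_C]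

/-- Raabe's duplication formula, evaluated at `0`. -/
theorem bernoulli_eval_half (n : ℕ) :
    2 * bernoulli n = 2 ^ n * (bernoulli n + (Polynomial.bernoulli n).eval (1 / 2)) := by
  set B := Polynomial.bernoulli (n + 1)
  set f : Polynomial ℚ := 2 * B.comp (Polynomial.C 2 * Polynomial.X) -
    Polynomial.C (2 ^ (n + 1)) * (B + B.comp (Polynomial.X + Polynomial.C (1 / 2)))
  have hf : f.derivative = 0 := by
    refine derivative_eq_zero_of_eval_add_half f fun x => ?_
    have h1 := Polynomial.bernoulli_eval_one_add (n + 1) (2 * x)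
    have h2 := Polynomial.bernoulli_eval_one_add (n + 1) x
    simp only [f, B, Polynomial.eval_sub, Polynomial.eval_mul, Polynomial.eval_add,
      Polynomial.eval_comp, Polynomial.eval_C, Polynomial.eval_X, Polynomial.eval_ofNat]
    rw [show 2 * (x + 1 / 2) = 1 + 2 * x by ring, show x + 1 / 2 + 1 / 2 = 1 + x by ring, h1, h2]
    simp only [Nat.add_sub_cancel, mul_pow]
    ring
  have h := congr_arg (Polynomial.eval 0) hf
  simp only [f, B, Polynomial.derivative_sub, Polynomial.derivative_mul, Polynomial.derivative_add,
    Polynomial.derivative_comp, Polynomial.derivative_bernoulli_add_one, Polynomial.derivative_C,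
    Polynomial.derivative_X, Polynomial.derivative_ofNat] at h
  simp at h
  have hn : ((n : ℚ) + 1) ≠ 0 := by positivity
  apply mul_left_cancel₀ hn
  rw [one_div]
  rw [pow_succ] at h
  linear_combination h / 2

theorem two_mul_half_eq_one {p q : ℕ} (hq : p = 2 * q + 1) : (2 : ZMod p) * (q + 1 : ℕ) = 1 := by
  have : ((2 * q + 1 : ℕ) : ZMod p) = 0 := by rw [← hq]; simp
  push_cast at this ⊢
  linear_combination this

/-- The power sum up to `(p - 1) / 2` modulo `p` in terms of the Bernoulli number. -/
theorem two_pow_mul_sum_pow_eq_bernoulli {p q n : ℕ} [Fact p.Prime] (hq : p = 2 * q + 1)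
    (hn : n + 2 < p) :
    (2 : ZMod p) ^ (n + 1) * ((n + 1 : ℕ) * ∑ k ∈ range (q + 1), (k : ZMod p) ^ n +
      2 * ((bernoulli (n + 1) : ℚ) : ZMod p)) = 2 * ((bernoulli (n + 1) : ℚ) : ZMod p) := by
  set R := ratCastSubring (ZMod p)
  set φ := ratCastSubringHom (ZMod p)
  have hp2 : 2 < p := by omega
  obtain ⟨P, hP⟩ : ∃ P : Polynomial R, P.map R.subtype = Polynomial.bernoulli (n + 1) := by
    refine (Polynomial.mem_lifts _).1 ((Polynomial.lifts_iff_coeff_lifts _).2 fun i => ?_)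
    rw [Polynomial.coeff_bernoulli]
    split_ifs
    · exact ⟨⟨_, mul_mem (bernoulli_mem_ratCastSubring (by omega)) (natCast_mem _ _)⟩, rfl⟩
    · exact ⟨0, rfl⟩
  have heval : ∀ x : R, ((P.eval x : R) : ℚ) = (Polynomial.bernoulli (n + 1)).eval (x : ℚ) := by
    intro x
    rw [← hP, Polynomial.eval_map]
    exact (Polynomial.eval₂_at_apply R.subtype x).symm
  let b : R := ⟨bernoulli (n + 1), bernoulli_mem_ratCastSubring (by omega)⟩
  let c : R := ⟨((2 : ℕ) : ℚ)⁻¹, inv_natCast_mem_ratCastSubring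
    (natCast_ne_zero_of_lt two_pos hp2)⟩
  have hsum : ((n + 1 : ℕ) : R) * ∑ k ∈ range (q + 1), (k : R) ^ n =
      P.eval ((q + 1 : ℕ) : R) - b := by
    apply Subtype.ext
    have := Polynomial.sum_range_pow_eq_bernoulli_sub (q + 1) n
    push_cast [heval] at this ⊢
    simpa [b] using this
  have h2R : ((2 : R) : ℚ) = 2 := rfl
  have hhalf : 2 * b = 2 ^ (n + 1) * (b + P.eval c) := by
    apply Subtype.ext
    have := bernoulli_eval_half (n + 1)
    push_cast [heval, h2R]
    simpa [b, c] using this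
  have hc : φ c = φ ((q + 1 : ℕ) : R) := by
    have h2 : (2 : ZMod p) ≠ 0 := by simpa using natCast_ne_zero_of_lt two_pos hp2
    apply mul_left_cancel₀ h2
    rw [map_natCast, two_mul_half_eq_one hq, ← map_ofNat φ 2, ← map_mul, ← map_one φ]
    congr 1
    apply Subtype.ext
    rw [Subring.coe_mul, h2R]
    simp [c]
  have hev : φ (P.eval c) = φ (P.eval ((q + 1 : ℕ) : R)) := by
    rw [← Polynomial.eval₂_at_apply, ← Polynomial.eval₂_at_apply, hc]
  have hb : φ b = ((bernoulli (n + 1) : ℚ) : ZMod p) := rfl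
  have h1 := congr_arg φ hsum
  have h2 := congr_arg φ hhalf
  simp only [map_mul, map_sub, map_add, map_sum, map_pow, map_natCast, map_ofNat, hb, hev] at h1 h2
  rw [h1]
  linear_combination -h2

theorem inv_pow_eq_pow {p s : ℕ} [Fact p.Prime] (hs : 0 < s) (hsp : s < p - 1) (x : ZMod p) :
    x⁻¹ ^ s = x ^ (p - 1 - s) := by
  rcases eq_or_ne x 0 with rfl | hx
  · rw [inv_zero, zero_pow hs.ne', zero_pow (by omega)]
  · rw [inv_pow, eq_comm]
    apply eq_inv_of_mul_eq_one_left
    rw [← pow_add, Nat.sub_add_cancel hsp.le, ZMod.pow_card_sub_one_eq_one hx]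

theorem sum_inv_pow_eq_zero {p s : ℕ} [Fact p.Prime] (hs : 0 < s) (hsp : s < p - 1) :
    ∑ x ∈ range p, (x : ZMod p)⁻¹ ^ s = 0 := by
  have h := FiniteField.sum_pow_lt_card_sub_one (ZMod p) (p - 1 - s) (by rw [ZMod.card]; omega)
  rw [← h]
  refine sum_bij' (fun x _ => (x : ZMod p)) (fun x _ => x.val) (by simp)
    (fun x _ => mem_range.2 x.val_lt) (fun x hx => ZMod.val_cast_of_lt (mem_range.1 hx))
    (fun x _ => ZMod.natCast_zmod_val x) fun x _ => inv_pow_eq_pow hs hsp _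

theorem sum_filter_even_range {M : Type*} [AddCommMonoid M] (g : ℕ → M) (q : ℕ) :
    ∑ x ∈ range (2 * q + 1) with x % 2 = 0, g x = ∑ k ∈ range (q + 1), g (2 * k) := by
  rw [sum_filter]
  induction q with
  | zero => simp
  | succ q ih =>
    rw [show 2 * (q + 1) + 1 = 2 * q + 1 + 1 + 1 by ring, sum_range_succ, sum_range_succ, ih,
      sum_range_succ _ (q + 1), if_neg (by omega), if_pos (by omega), add_zero]
    ring_nf

theorem sum_range_filter_even_add_odd {M : Type*} [AddCommMonoid M] (g : ℕ → M) (n : ℕ) :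
    ∑ x ∈ range n with x % 2 = 0, g x + ∑ x ∈ range n with x % 2 = 1, g x =
      ∑ x ∈ range n, g x := by
  rw [← sum_filter_add_sum_filter_not (range n) (fun x => x % 2 = 0) g]
  simp only [Nat.mod_two_not_eq_zero]

theorem sum_odd_eq_sum_even_of_even {p r : ℕ} [Fact p.Prime] (hp : p % 2 = 1) (hr : 0 < r)
    (hr2 : Even r) :
    ∑ x ∈ range p with x % 2 = 1, (x : ZMod p)⁻¹ ^ r =
      ∑ x ∈ range p with x % 2 = 0, (x : ZMod p)⁻¹ ^ r := by
  have h0 : ∑ x ∈ range p with x % 2 = 0, (x : ZMod p)⁻¹ ^ r =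
      ∑ x ∈ range p with 0 < x ∧ x % 2 = 0, (x : ZMod p)⁻¹ ^ r := by
    refine (sum_subset (fun x => by grind) fun x hx hx' => ?_).symm
    have : x = 0 := by grind
    simp [this, hr.ne']
  rw [h0]
  refine sum_bij' (fun x _ => p - x) (fun x _ => p - x) ?_ ?_ ?_ ?_ ?_
  · grind
  · grind
  · grind
  · grind
  · intro x hx
    have : x ≤ p := by grind
    rw [Nat.cast_sub this, ZMod.natCast_self, zero_sub, inv_neg, hr2.neg_pow]

theorem two_mul_sum_lt_mul {R : Type*} [CommRing R] {p : ℕ} (g : ℕ → R) (P : ℕ → Prop)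
    [DecidablePred P] :
    2 * ∑ m : Fin 2 → Fin p with (m 1 : ℕ) < m 0 ∧ P (m 0) ∧ P (m 1), g (m 0) * g (m 1) =
      (∑ x ∈ range p with P x, g x) ^ 2 - ∑ x ∈ range p with P x, g x ^ 2 := by
  set f : Fin p → R := fun x => if P x then g x else 0
  have h1 : ∑ x ∈ range p with P x, g x = ∑ x, f x := by
    rw [sum_filter, ← Fin.sum_univ_eq_sum_range (fun x => if P x then g x else 0)]
  have h2 : ∑ x ∈ range p with P x, g x ^ 2 = ∑ x, f x * f x := by
    rw [sum_filter, ← Fin.sum_univ_eq_sum_range (fun x => if P x then g x ^ 2 else 0)]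
    refine sum_congr rfl fun x _ => ?_
    simp only [f]
    split_ifs <;> ring
  have h3 : ∑ m : Fin 2 → Fin p with (m 1 : ℕ) < m 0 ∧ P (m 0) ∧ P (m 1), g (m 0) * g (m 1) =
      ∑ x, ∑ y, if y < x then f x * f y else 0 := by
    rw [sum_filter, ← (finTwoArrowEquiv (Fin p)).symm.sum_comp, Fintype.sum_prod_type]
    refine sum_congr rfl fun x _ => sum_congr rfl fun y _ => ?_
    simp only [finTwoArrowEquiv_symm_apply, Matrix.cons_val_zero, Matrix.cons_val_one, f,
      Fin.lt_def]
    split_ifs <;> grind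
  have h4 : ∑ x, ∑ y, (if y < x then f x * f y else 0) =
      ∑ x, ∑ y, if x < y then f x * f y else 0 := by
    rw [sum_comm]
    simp only [mul_comm]
  have h5 : ∑ x, f x * f x = ∑ x, ∑ y, if x = y then f x * f y else 0 := by simp
  rw [h1, h2, h3, two_mul, h5, sq, sum_mul_sum, eq_sub_iff_add_eq]
  nth_rw 2 [h4]
  simp only [← sum_add_distrib]
  refine sum_congr rfl fun x _ => sum_congr rfl fun y _ => ?_
  rcases lt_trichotomy x y with h | h | h
  · simp [h, h.ne, h.not_gt]
  · simp [h]
  · simp [h, h.ne', h.not_gt]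

theorem two_mul_tp {p s : ℕ} :
    2 * tp p 2 ![s, s] = (∑ x ∈ range p with x % 2 = 1, (x : ZMod p)⁻¹ ^ s) ^ 2 -
      ∑ x ∈ range p with x % 2 = 1, (x : ZMod p)⁻¹ ^ (2 * s) := by
  simp only [mul_comm 2 s, pow_mul]
  rw [← two_mul_sum_lt_mul, tp]
  congr 1
  refine sum_congr (filter_congr fun m _ => ?_) fun m _ => by simp
  simp only [Fin.forall_fin_two]
  grind

theorem two_mul_zeta2p {p s : ℕ} (hs : 0 < s) :
    2 * zeta2p p 2 ![s, s] = (∑ x ∈ range p with x % 2 = 0, (x : ZMod p)⁻¹ ^ s) ^ 2 -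
      ∑ x ∈ range p with x % 2 = 0, (x : ZMod p)⁻¹ ^ (2 * s) := by
  simp only [mul_comm 2 s, pow_mul]
  rw [← two_mul_sum_lt_mul, zeta2p]
  congr 1
  refine sum_subset_zero_on_sdiff (fun m => ?_) (fun m hm => ?_) fun m _ => by simp
  · simp only [mem_filter_univ, Fin.forall_fin_two]
    grind
  · simp only [mem_sdiff, mem_filter_univ, Fin.forall_fin_two] at hm
    have : (m 1 : ℕ) = 0 := by grind
    simp [this, ZMod.inv_zero, hs.ne']

/-- For `s ≥ 2` and a prime `p > 2s + 1`:
`t_p(s,s) = ζ^{(2)}_p(s,s) = (1 - 2^{1-s})^2 B_{p-s}^2 / (2s^2)` in `ℤ/pℤ`,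
where `2^{1-s}` is the inverse of `2^{s-1}` and `B_{p-s}` is the `(p-s)`-th
Bernoulli number reduced mod `p`. -/
theorem stmt5 (p s : ℕ) [Fact p.Prime] (hs : 2 ≤ s) (hps : 2 * s + 1 < p) :
    tp p 2 ![s, s] = zeta2p p 2 ![s, s] ∧
    tp p 2 ![s, s] =
      (1 - ((2 : ZMod p) ^ (s - 1))⁻¹) ^ 2 *
        ((bernoulli (p - s) : ℚ) : ZMod p) ^ 2 / (2 * (s : ZMod p) ^ 2) := by
  have hp : p.Prime := Fact.out
  obtain ⟨q, hq⟩ : ∃ q, p = 2 * q + 1 := hp.odd_of_ne_two (by omega)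
  have h2 : (2 : ZMod p) ≠ 0 := by
    simpa using natCast_ne_zero_of_lt (p := p) two_pos (by omega)
  have hs0 : (s : ZMod p) ≠ 0 := natCast_ne_zero_of_lt (by omega) (by omega)
  have hadd : ∀ r, 0 < r → r < p - 1 →
      ∑ x ∈ range p with x % 2 = 1, (x : ZMod p)⁻¹ ^ r =
        -∑ x ∈ range p with x % 2 = 0, (x : ZMod p)⁻¹ ^ r := by
    intro r hr hrp
    rw [eq_neg_iff_add_eq_zero, add_comm, sum_range_filter_even_add_odd,
      sum_inv_pow_eq_zero hr hrp]
  have hE2 : ∑ x ∈ range p with x % 2 = 0, (x : ZMod p)⁻¹ ^ (2 * s) = 0 := by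
    have h := hadd (2 * s) (by omega) (by omega)
    rw [sum_odd_eq_sum_even_of_even (by omega) (by omega) (even_two_mul s), eq_neg_iff_add_eq_zero,
      ← two_mul] at h
    exact (mul_eq_zero.1 h).resolve_left h2
  have hE : ∑ x ∈ range p with x % 2 = 0, (x : ZMod p)⁻¹ ^ s =
      -((1 - ((2 : ZMod p) ^ (s - 1))⁻¹) * ((bernoulli (p - s) : ℚ) : ZMod p)) / s := by
    obtain ⟨t, rfl⟩ : ∃ t, s = t + 1 := ⟨s - 1, by omega⟩
    obtain ⟨n, hn⟩ : ∃ n, p = n + 1 + (t + 1) := ⟨p - t - 2, by omega⟩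
    have hS := two_pow_mul_sum_pow_eq_bernoulli (n := n) hq (by omega)
    have hpow : (2 : ZMod p) ^ (n + 1) * 2 ^ t = 1 := by
      rw [← pow_add, show n + 1 + t = p - 1 by omega, ZMod.pow_card_sub_one_eq_one h2]
    have hns : ((n + 1 : ℕ) : ZMod p) = -((t + 1 : ℕ) : ZMod p) := by
      rw [eq_neg_iff_add_eq_zero, ← Nat.cast_add, ← hn, ZMod.natCast_self]
    have hreindex : ∑ x ∈ range p with x % 2 = 0, (x : ZMod p)⁻¹ ^ (t + 1) =
        ((2 : ZMod p) ^ (t + 1))⁻¹ * ∑ k ∈ range (q + 1), (k : ZMod p) ^ n := by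
      have := sum_filter_even_range (fun x => (x : ZMod p)⁻¹ ^ (t + 1)) q
      rw [← hq] at this
      rw [this, mul_sum]
      refine sum_congr rfl fun k _ => ?_
      rw [Nat.cast_mul, mul_inv, mul_pow, inv_pow_eq_pow (x := (k : ZMod p)) (by omega) (by omega),
        show p - 1 - (t + 1) = n by omega, inv_pow, Nat.cast_ofNat]
    rw [hreindex, show p - (t + 1) = n + 1 by omega, Nat.add_sub_cancel]
    rw [hns] at hS
    generalize ((t + 1 : ℕ) : ZMod p) = a at *
    generalize ∑ k ∈ range (q + 1), (k : ZMod p) ^ n = S at *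
    generalize ((bernoulli (n + 1) : ℚ) : ZMod p) = b at *
    have ht : (2 : ZMod p) ^ t ≠ 0 := pow_ne_zero _ h2
    have hS' : -a * S + 2 * b = 2 * b * 2 ^ t := by
      linear_combination 2 ^ t * hS - (-a * S + 2 * b) * hpow
    rw [pow_succ]
    field_simp
    linear_combination -hS'
  have hT := two_mul_tp (p := p) (s := s)
  have hZ := two_mul_zeta2p (p := p) (s := s) (by omega)
  rw [hadd _ (by omega) (by omega), hadd _ (by omega) (by omega), hE2, hE] at hT
  rw [hE2, hE] at hZ
  refine ⟨mul_left_cancel₀ h2 (by rw [hT, hZ]; ring), mul_left_cancel₀ h2 ?_⟩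
  rw [hT]
  field_simp
  ring
end

section
/- Let a, b be positive integers with w = a + b odd, and let p be a prime with p > w. Then in ℤ/pℤ: S_p(a,b) = T_p(a,b) = ((−1)^a / 2) · (1 − 2^{−w}) · C(w,a) · B_{p−w} / w, where C(w,a) is the binomial coefficient, 2^{−w} denotes the inverse of 2^w in ℤ/pℤ, and B_{p−w} is the (p−w)-th Bernoulli number reduced mod p. -/
open Finset

/-- `T_p(a,b) ∈ ℤ/pℤ`: the sum over `p > m > n > 0` with `m` even and `n` odd of
`m^{-a} n^{-b}`, inverses taken in `ℤ/pℤ`. -/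
def Tp2 (p a b : ℕ) : ZMod p :=
  ∑ m ∈ (Finset.Ioo 0 p).filter (fun m => m % 2 = 0),
    ∑ n ∈ (Finset.Ioo 0 m).filter (fun n => n % 2 = 1),
      ((m : ZMod p))⁻¹ ^ a * ((n : ZMod p))⁻¹ ^ b

/-- `S_p(a,b) ∈ ℤ/pℤ`: the sum over `p > m > n > 0` with `m` odd and `n` even of
`m^{-a} n^{-b}`, inverses taken in `ℤ/pℤ`. -/
def Sp2 (p a b : ℕ) : ZMod p :=
  ∑ m ∈ (Finset.Ioo 0 p).filter (fun m => m % 2 = 1),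
    ∑ n ∈ (Finset.Ioo 0 m).filter (fun n => n % 2 = 0),
      ((m : ZMod p))⁻¹ ^ a * ((n : ZMod p))⁻¹ ^ b

/-- The subring of rationals whose denominator does not vanish in the field `K`. -/
def ratIntegral (K : Type*) [Field K] : Subring ℚ where
  carrier := {q | (q.den : K) ≠ 0}
  mul_mem' {x y} hx hy h := by
    obtain ⟨c, hc⟩ := Rat.mul_den_dvd x y
    have := mul_ne_zero hx hy
    rw [← Nat.cast_mul, hc, Nat.cast_mul, h, zero_mul] at this
    exact this rfl
  add_mem' {x y} hx hy h := by
    obtain ⟨c, hc⟩ := Rat.add_den_dvd x y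
    have := mul_ne_zero hx hy
    rw [← Nat.cast_mul, hc, Nat.cast_mul, h, zero_mul] at this
    exact this rfl
  one_mem' := by simp
  zero_mem' := by simp
  neg_mem' {x} hx := by simpa using hx

/-- The canonical cast of rationals to `K`, as a ring homomorphism on its domain of validity. -/
def ratIntegralCast (K : Type*) [Field K] : ratIntegral K →+* K where
  toFun q := ((q : ℚ) : K)
  map_one' := by simp
  map_zero' := by simp
  map_mul' x y := Rat.cast_mul_of_ne_zero x.2 y.2
  map_add' x y := Rat.cast_add_of_ne_zero x.2 y.2

/-- The sum of the `s`-th powers of the naturals below `m` that are congruent to `r` mod 2. -/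
def paritySum (p s r m : ℕ) : ZMod p :=
  ∑ n ∈ range m, if n % 2 = r then (n : ZMod p) ^ s else 0

section

variable {p : ℕ} [Fact p.Prime]

theorem natCast_zmod_ne_zero {n : ℕ} (h0 : 0 < n) (hn : n < p) : (n : ZMod p) ≠ 0 := by
  rw [Ne, ZMod.natCast_eq_zero_iff]
  exact Nat.not_dvd_of_pos_of_lt h0 hn

theorem inv_natCast_mem_ratIntegral {n : ℕ} (h0 : 0 < n) (hn : n < p) :
    ((n : ℚ)⁻¹) ∈ ratIntegral (ZMod p) := by
  change (((n : ℚ)⁻¹).den : ZMod p) ≠ 0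
  rw [Rat.inv_natCast_den_of_pos h0]
  exact natCast_zmod_ne_zero h0 hn

theorem bernoulli_mem_ratIntegral {n : ℕ} (hn : n + 1 < p) :
    bernoulli n ∈ ratIntegral (ZMod p) := by
  induction n using Nat.strong_induction_on with
  | _ n ih =>
    have h := sum_bernoulli (n + 1)
    rw [sum_range_succ, Nat.choose_succ_self_right] at h
    have hne : ((n + 1 : ℕ) : ℚ) ≠ 0 := by positivity
    have e : bernoulli n = ((n + 1 : ℕ) : ℚ)⁻¹ * ((if n + 1 = 1 then 1 else 0) -
        ∑ k ∈ range n, ((n + 1).choose k : ℚ) * bernoulli k) := by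
      rw [← h]; field_simp; ring
    rw [e]
    refine mul_mem (inv_natCast_mem_ratIntegral n.succ_pos hn) (sub_mem ?_ (sum_mem ?_))
    · split_ifs
      exacts [one_mem _, zero_mem _]
    · intro k hk
      have := mem_range.1 hk
      exact mul_mem (natCast_mem _ _) (ih k this (by omega))

/-- Faulhaber's polynomial over `ℤ/pℤ`. -/
def faulhaber (p s : ℕ) [Fact p.Prime] (x : ZMod p) : ZMod p :=
  (∑ i ∈ range (s + 1), ((bernoulli i : ℚ) : ZMod p) * ((s + 1).choose i : ZMod p) *
    x ^ (s + 1 - i)) / ((s + 1 : ℕ) : ZMod p)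

theorem sum_range_pow_zmod {s : ℕ} (hs : s + 1 < p) (m : ℕ) :
    ∑ n ∈ range m, (n : ZMod p) ^ s = faulhaber p s m := by
  rw [faulhaber, eq_div_iff (natCast_zmod_ne_zero s.succ_pos hs)]
  let β : ℕ → ratIntegral (ZMod p) := fun i =>
    if h : i + 1 < p then ⟨bernoulli i, bernoulli_mem_ratIntegral h⟩ else 0
  have hβ {i : ℕ} (hi : i ∈ range (s + 1)) : (β i : ℚ) = bernoulli i := by
    have := mem_range.1 hi
    simp [β, show i + 1 < p by omega]
  have key : (∑ n ∈ range m, (n : ratIntegral (ZMod p)) ^ s) * ((s + 1 : ℕ) : ratIntegral (ZMod p))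
      = ∑ i ∈ range (s + 1), β i * ((s + 1).choose i : ratIntegral (ZMod p)) *
        (m : ratIntegral (ZMod p)) ^ (s + 1 - i) := by
    apply Subtype.ext
    push_cast
    rw [sum_range_pow, sum_mul]
    refine sum_congr rfl fun i hi => ?_
    rw [hβ hi, div_mul_cancel₀ _ (by positivity)]
  have h := congrArg (ratIntegralCast (ZMod p)) key
  simp only [map_sum, map_mul, map_pow, map_natCast] at h
  rw [h]
  refine sum_congr rfl fun i hi => ?_
  rw [← hβ hi]
  rfl

theorem sum_range_pow_eq_ite {k : ℕ} (h0 : 0 < k) (hk : k < 2 * (p - 1)) :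
    ∑ m ∈ range p, (m : ZMod p) ^ k = if k = p - 1 then -1 else 0 := by
  have hp := (Fact.out : p.Prime).two_le
  have huniv : ∑ m ∈ range p, (m : ZMod p) ^ k = ∑ x : ZMod p, x ^ k := by
    refine sum_nbij (fun m => (m : ZMod p)) (by simp) ?_ ?_ (by simp)
    · intro m hm n hn h
      have hm := mem_range.1 (mem_coe.1 hm)
      have hn := mem_range.1 (mem_coe.1 hn)
      simpa [ZMod.natCast_eq_natCast_iff', Nat.mod_eq_of_lt hm, Nat.mod_eq_of_lt hn] using h
    · intro x _
      exact ⟨x.val, by simpa using ZMod.val_lt x, by simp⟩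
  rw [huniv]
  split_ifs with hkp
  · subst hkp
    have hpow (x : ZMod p) : x ^ (p - 1) = 1 - if x = 0 then 1 else 0 := by
      split_ifs with hx
      · rw [hx, zero_pow h0.ne', sub_self]
      · rw [ZMod.pow_card_sub_one_eq_one hx, sub_zero]
    simp [hpow]
  · rcases lt_or_ge k (p - 1) with h | h
    · exact FiniteField.sum_pow_lt_card_sub_one _ k (by rwa [ZMod.card])
    · obtain ⟨j, rfl⟩ := Nat.exists_eq_add_of_le h
      have hpow (x : ZMod p) : x ^ (p - 1 + j) = x ^ j := by
        by_cases hx : x = 0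
        · rw [hx, zero_pow h0.ne', zero_pow (by omega)]
        · rw [pow_add, ZMod.pow_card_sub_one_eq_one hx, one_mul]
      simp only [hpow]
      exact FiniteField.sum_pow_lt_card_sub_one _ j (by rw [ZMod.card]; omega)

theorem faulhaber_coeff {s t a : ℕ} (c : ZMod p) (ha : 0 < a) (has : a ≤ s + 1)
    (hta : t + a = p - 1) (ht : 0 < t) (hts : t + s + 1 < 2 * (p - 1)) :
    ∑ m ∈ range p, (m : ZMod p) ^ t * faulhaber p s (c * m) =
      -(((bernoulli (s + 1 - a) : ℚ) : ZMod p) * ((s + 1).choose a : ZMod p) * c ^ a /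
        ((s + 1 : ℕ) : ZMod p)) := by
  simp only [faulhaber, mul_div_assoc', mul_sum, ← sum_div, ← neg_div]
  congr 1
  rw [sum_comm, sum_eq_single (s + 1 - a)]
  · have e : s + 1 - (s + 1 - a) = a := by omega
    rw [e, Nat.choose_symm has]
    have : ∀ m : ℕ, (m : ZMod p) ^ t * (((bernoulli (s + 1 - a) : ℚ) : ZMod p) *
        ((s + 1).choose a : ZMod p) * (c * m) ^ a) = ((bernoulli (s + 1 - a) : ℚ) : ZMod p) *
        ((s + 1).choose a : ZMod p) * c ^ a * (m : ZMod p) ^ (t + a) := fun m => by ring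
    simp only [this]
    rw [← mul_sum, sum_range_pow_eq_ite (by omega) (by omega), if_pos hta]
    ring
  · intro i hi hne
    have := mem_range.1 hi
    have h (m : ℕ) : (m : ZMod p) ^ t * (((bernoulli i : ℚ) : ZMod p) *
        ((s + 1).choose i : ZMod p) * (c * m) ^ (s + 1 - i)) = ((bernoulli i : ℚ) : ZMod p) *
        ((s + 1).choose i : ZMod p) * c ^ (s + 1 - i) * (m : ZMod p) ^ (t + (s + 1 - i)) := by ring
    simp only [h]
    rw [← mul_sum, sum_range_pow_eq_ite (by omega) (by omega), if_neg (by omega), mul_zero]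
  · intro h
    exact absurd (mem_range.2 (by omega)) h

theorem choose_sub_zmod {b : ℕ} (hb : 0 < b) : ∀ {a : ℕ}, a + b ≤ p →
    ((p - b).choose a : ZMod p) = (-1) ^ a * ((a + b - 1).choose a : ZMod p)
  | 0, _ => by simp
  | a + 1, h => by
    have ih := choose_sub_zmod hb (a := a) (by omega)
    have hne : ((a + 1 : ℕ) : ZMod p) ≠ 0 := natCast_zmod_ne_zero a.succ_pos (by omega)
    have h1 := congrArg (Nat.cast (R := ZMod p)) (Nat.choose_succ_right_eq (p - b) a)
    have h2 := congrArg (Nat.cast (R := ZMod p)) (Nat.choose_succ_right_eq (a + b) a)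
    have h3 := congrArg (Nat.cast (R := ZMod p)) (Nat.choose_mul_succ_eq (a + b - 1) a)
    have e1 : a + b - 1 + 1 = a + b := by omega
    have e2 : a + b - a = b := by omega
    rw [e1, e2] at h3
    rw [e2] at h2
    have e3 : ((p - b - a : ℕ) : ZMod p) = -((a + b : ℕ) : ZMod p) := by
      rw [Nat.sub_sub, Nat.cast_sub (by omega), CharP.cast_eq_zero]
      push_cast; ring
    simp only [Nat.cast_mul] at h1 h2 h3
    rw [e3, ih] at h1
    apply mul_right_cancel₀ hne
    rw [h1, show a + 1 + b - 1 = a + b by omega, mul_assoc, mul_assoc, h2, ← h3]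
    ring

theorem paritySum_succ (s r m : ℕ) :
    paritySum p s r (m + 1) = paritySum p s r m + if m % 2 = r then (m : ZMod p) ^ s else 0 :=
  sum_range_succ _ _

theorem paritySum_zero_add_one (s m : ℕ) :
    paritySum p s 0 m + paritySum p s 1 m = ∑ n ∈ range m, (n : ZMod p) ^ s := by
  rw [paritySum, paritySum, ← sum_add_distrib]
  refine sum_congr rfl fun n _ => ?_
  rcases Nat.mod_two_eq_zero_or_one n with h | h <;> simp [h]

theorem paritySum_zero_two_mul (s k : ℕ) :
    paritySum p s 0 (2 * k) = 2 ^ s * ∑ n ∈ range k, (n : ZMod p) ^ s := by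
  induction k with
  | zero => simp [paritySum]
  | succ k ih =>
    rw [mul_add_one, paritySum_succ, paritySum_succ, ih, sum_range_succ, if_pos (by omega),
      if_neg (by omega)]
    push_cast
    ring

theorem paritySum_zero_add (hp : p % 2 = 1) (s m : ℕ) :
    paritySum p s 0 (p + m) = paritySum p s 0 p + paritySum p s 1 m := by
  induction m with
  | zero => simp [paritySum]
  | succ m ih =>
    rw [← add_assoc, paritySum_succ, paritySum_succ, ih, add_assoc]
    simp only [Nat.cast_add, CharP.cast_eq_zero, zero_add]
    congr 2
    rcases Nat.mod_two_eq_zero_or_one m with h | h <;> simp [h, Nat.add_mod, hp]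

theorem two_zmod_ne_zero (hp : p % 2 = 1) : (2 : ZMod p) ≠ 0 := by
  have := (Fact.out : p.Prime).two_le
  exact_mod_cast natCast_zmod_ne_zero (p := p) (n := 2) (by omega) (by omega)

theorem paritySum_zero_eq_faulhaber {s m : ℕ} (hp : p % 2 = 1) (hs : s + 1 < p)
    (hm : m % 2 = 0) : paritySum p s 0 m = 2 ^ s * faulhaber p s (2⁻¹ * m) := by
  obtain ⟨k, rfl⟩ : 2 ∣ m := Nat.dvd_of_mod_eq_zero hm
  rw [paritySum_zero_two_mul, sum_range_pow_zmod hs]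
  push_cast
  rw [inv_mul_cancel_left₀ (two_zmod_ne_zero hp)]

theorem paritySum_one_of_even {s m : ℕ} (hp : p % 2 = 1) (hs : s + 1 < p) (hm : m % 2 = 0) :
    paritySum p s 1 m = faulhaber p s (1 * m) - 2 ^ s * faulhaber p s (2⁻¹ * m) := by
  rw [← paritySum_zero_eq_faulhaber hp hs hm, one_mul, ← sum_range_pow_zmod hs,
    ← paritySum_zero_add_one]
  ring

theorem paritySum_zero_of_odd {s m : ℕ} (hp : p % 2 = 1) (hs : s + 1 < p) (hm : m % 2 = 1) :
    paritySum p s 0 m = faulhaber p s (1 * m) - 2 ^ s * faulhaber p s (2⁻¹ * m) +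
      paritySum p s 0 p := by
  have h := paritySum_zero_eq_faulhaber hp hs (m := p + m) (by omega)
  rw [paritySum_zero_add hp, Nat.cast_add, CharP.cast_eq_zero, zero_add] at h
  rw [← h, one_mul, ← sum_range_pow_zmod hs, ← paritySum_zero_add_one]
  ring

theorem paritySum_self_eq_zero {s : ℕ} (hp : p % 2 = 1) (h0 : 0 < s) (hs : s < p - 1)
    (he : Even s) {r : ℕ} (hr : r < 2) : paritySum p s r p = 0 := by
  have hsum : paritySum p s 0 p + paritySum p s 1 p = 0 := by
    rw [paritySum_zero_add_one, sum_range_pow_eq_ite h0 (by omega), if_neg hs.ne]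
  have hrefl : paritySum p s 0 p = paritySum p s 1 p := by
    have h0' (r : ℕ) : paritySum p s r p =
        ∑ n ∈ Ioo 0 p, if n % 2 = r then (n : ZMod p) ^ s else 0 := by
      rw [paritySum]
      refine (sum_subset (fun n hn => mem_range.2 (mem_Ioo.1 hn).2) fun n hn hn' => ?_).symm
      have : n = 0 := by simp at hn hn'; omega
      simp [this, h0.ne']
    rw [h0', h0']
    refine sum_nbij' (fun n => p - n) (fun n => p - n) ?_ ?_ ?_ ?_ ?_
    · simp only [mem_Ioo]; omega
    · simp only [mem_Ioo]; omega
    · simp only [mem_Ioo]; omega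
    · simp only [mem_Ioo]; omega
    · intro n hn
      have hn := mem_Ioo.1 hn
      rw [Nat.cast_sub hn.2.le, ZMod.natCast_self, zero_sub, he.neg_pow]
      exact if_congr (by omega) rfl rfl
  rw [← hrefl, ← two_mul, mul_eq_zero] at hsum
  have hz := hsum.resolve_left (two_zmod_ne_zero hp)
  interval_cases r
  exacts [hz, hrefl ▸ hz]

theorem inv_pow_eq_pow_s11 {x : ZMod p} (hx : x ≠ 0) {a t : ℕ} (h : t + a = p - 1) :
    x⁻¹ ^ a = x ^ t := by
  rw [inv_pow, inv_eq_iff_eq_inv, ← mul_eq_one_iff_eq_inv₀ (pow_ne_zero _ hx), ← pow_add,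
    add_comm, h, ZMod.pow_card_sub_one_eq_one hx]

theorem sum_filter_inv_pow {a t r m : ℕ} (h : t + a = p - 1) (ht : 0 < t) (hm : m ≤ p) :
    ∑ n ∈ (Ioo 0 m).filter (fun n => n % 2 = r), (n : ZMod p)⁻¹ ^ a = paritySum p t r m := by
  rw [sum_filter, paritySum]
  refine (sum_congr rfl fun n hn => ?_).trans
    (sum_subset (fun n hn => mem_range.2 (mem_Ioo.1 hn).2) fun n hn hn' => ?_)
  · have hn := mem_Ioo.1 hn
    rw [inv_pow_eq_pow_s11 (natCast_zmod_ne_zero hn.1 (by omega)) h]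
  · have : n = 0 := by simp at hn hn'; omega
    simp [this, ht.ne']

theorem sum_filter_sum_filter_eq {a b t s r r' : ℕ} (hta : t + a = p - 1) (ht : 0 < t)
    (hsb : s + b = p - 1) (hs : 0 < s) :
    ∑ m ∈ (Ioo 0 p).filter (fun m => m % 2 = r),
      ∑ n ∈ (Ioo 0 m).filter (fun n => n % 2 = r'), (m : ZMod p)⁻¹ ^ a * (n : ZMod p)⁻¹ ^ b =
    ∑ m ∈ range p, if m % 2 = r then (m : ZMod p) ^ t * paritySum p s r' m else 0 := by
  rw [sum_filter]
  refine (sum_congr rfl fun m hm => ?_).trans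
    (sum_subset (fun n hn => mem_range.2 (mem_Ioo.1 hn).2) fun n hn hn' => ?_)
  · have hm := mem_Ioo.1 hm
    rw [← mul_sum, sum_filter_inv_pow hsb hs hm.2.le,
      inv_pow_eq_pow_s11 (natCast_zmod_ne_zero hm.1 hm.2) hta]
  · have : n = 0 := by simp at hn hn'; omega
    simp [this, ht.ne']

theorem Sp2_reflect (a b : ℕ) (hp : p % 2 = 1) : Sp2 p b a = (-1) ^ (a + b) * Sp2 p a b := by
  rw [Sp2, Sp2, sum_sigma', sum_sigma', mul_sum]
  refine sum_nbij' (fun x => ⟨p - x.2, p - x.1⟩) (fun x => ⟨p - x.2, p - x.1⟩) ?_ ?_ ?_ ?_ ?_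
  · simp only [mem_sigma, mem_filter, mem_Ioo]; omega
  · simp only [mem_sigma, mem_filter, mem_Ioo]; omega
  · rintro ⟨m, n⟩ h
    simp only [mem_sigma, mem_filter, mem_Ioo] at h
    simp only [Sigma.mk.injEq, heq_eq_eq]; omega
  · rintro ⟨m, n⟩ h
    simp only [mem_sigma, mem_filter, mem_Ioo] at h
    simp only [Sigma.mk.injEq, heq_eq_eq]; omega
  · rintro ⟨m, n⟩ h
    simp only [mem_sigma, mem_filter, mem_Ioo] at h
    rw [Nat.cast_sub (show n ≤ p by omega), Nat.cast_sub (show m ≤ p by omega),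
      ZMod.natCast_self, zero_sub, zero_sub,
      inv_neg, inv_neg, neg_pow (n : ZMod p)⁻¹, neg_pow (m : ZMod p)⁻¹]
    have h1 : ((-1 : ZMod p) ^ a) * (-1) ^ a = 1 := by rw [← mul_pow]; simp
    have h2 : ((-1 : ZMod p) ^ b) * (-1) ^ b = 1 := by rw [← mul_pow]; simp
    rw [pow_add]
    linear_combination (-(m : ZMod p)⁻¹ ^ b * (n : ZMod p)⁻¹ ^ a) * (h1 + h2 * (-1) ^ a * (-1) ^ a)

theorem Tp2_add_Sp2_swap (p a b : ℕ) :
    Tp2 p a b + Sp2 p b a =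
      (∑ m ∈ (Ioo 0 p).filter (fun m => m % 2 = 0), (m : ZMod p)⁻¹ ^ a) *
        ∑ n ∈ (Ioo 0 p).filter (fun n => n % 2 = 1), (n : ZMod p)⁻¹ ^ b := by
  have hcomm : Sp2 p b a = ∑ m ∈ (Ioo 0 p).filter (fun m => m % 2 = 0),
      ∑ n ∈ (Ioo m p).filter (fun n => n % 2 = 1), (m : ZMod p)⁻¹ ^ a * (n : ZMod p)⁻¹ ^ b := by
    rw [Sp2, sum_comm' (t' := (Ioo 0 p).filter (fun m => m % 2 = 0))
      (s' := fun m => (Ioo m p).filter (fun n => n % 2 = 1))]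
    · simp only [mul_comm]
    · simp only [mem_filter, mem_Ioo]; omega
  rw [hcomm, Tp2, ← sum_add_distrib, sum_mul_sum]
  refine sum_congr rfl fun m hm => ?_
  rw [← sum_union]
  · refine sum_congr ?_ fun _ _ => rfl
    ext n
    simp only [mem_filter, mem_Ioo, mem_union] at hm ⊢
    omega
  · rw [disjoint_left]
    simp only [mem_filter, mem_Ioo]
    omega

theorem paritySum_mul_paritySum_eq_zero {s t r r' : ℕ} (hp : p % 2 = 1) (hs : 0 < s)
    (hs' : s < p - 1) (ht : 0 < t) (ht' : t < p - 1) (hst : Odd (s + t)) (hr : r < 2)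
    (hr' : r' < 2) : paritySum p s r p * paritySum p t r' p = 0 := by
  rcases Nat.even_or_odd s with h | h
  · rw [paritySum_self_eq_zero hp hs hs' h hr, zero_mul]
  · rw [paritySum_self_eq_zero hp ht ht' (by grind) hr', mul_zero]

theorem Tp2_eq_Sp2 {a b : ℕ} (ha : 0 < a) (hb : 0 < b) (hw : Odd (a + b)) (hp : a + b < p)
    (hp2 : p % 2 = 1) : Tp2 p a b = Sp2 p a b := by
  have h := Tp2_add_Sp2_swap p a b
  rw [sum_filter_inv_pow (t := p - 1 - a) (by omega) (by omega) le_rfl,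
    sum_filter_inv_pow (t := p - 1 - b) (by omega) (by omega) le_rfl,
    paritySum_mul_paritySum_eq_zero hp2 (by omega) (by omega) (by omega) (by omega)
      (by rw [Nat.odd_iff] at hw ⊢; omega) (by omega) (by omega),
    Sp2_reflect a b hp2, hw.neg_one_pow] at h
  linear_combination h

theorem Tp2_add_Sp2 {a b t s : ℕ} (hta : t + a = p - 1) (ht : 0 < t) (hsb : s + b = p - 1)
    (hs : 0 < s) (hb : 0 < b) (hp2 : p % 2 = 1) :
    Tp2 p a b + Sp2 p a b =
      ∑ m ∈ range p, (m : ZMod p) ^ t * faulhaber p s (1 * m) -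
        2 ^ s * ∑ m ∈ range p, (m : ZMod p) ^ t * faulhaber p s (2⁻¹ * m) +
        paritySum p s 0 p * paritySum p t 1 p := by
  have hsp : s + 1 < p := by omega
  rw [Tp2, Sp2, sum_filter_sum_filter_eq hta ht hsb hs, sum_filter_sum_filter_eq hta ht hsb hs,
    paritySum.eq_def p t, mul_sum, mul_sum, ← sum_add_distrib, ← sum_sub_distrib,
    ← sum_add_distrib]
  refine sum_congr rfl fun m _ => ?_
  rcases Nat.mod_two_eq_zero_or_one m with h | h
  · simp only [h, if_true, zero_ne_one, if_false, paritySum_one_of_even hp2 hsp h]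
    ring
  · simp only [h, if_true, one_ne_zero, if_false, paritySum_zero_of_odd hp2 hsp h]
    ring

end

/-- For positive integers `a, b` with `w = a + b` odd and a prime `p > w`:
`S_p(a,b) = T_p(a,b) = ((-1)^a/2)(1 - 2^{-w}) C(w,a) B_{p-w}/w` in `ℤ/pℤ`. -/
theorem stmt11 (p a b : ℕ) [Fact p.Prime] (ha : 0 < a) (hb : 0 < b)
    (hw : Odd (a + b)) (hp : a + b < p) :
    Sp2 p a b = Tp2 p a b ∧
    Sp2 p a b =
      ((-1 : ZMod p) ^ a / 2) * (1 - ((2 : ZMod p) ^ (a + b))⁻¹) *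
        ((a + b).choose a : ZMod p) *
        ((bernoulli (p - (a + b)) : ℚ) : ZMod p) / ((a + b : ℕ) : ZMod p) := by
  have hw3 : 3 ≤ a + b := by rw [Nat.odd_iff] at hw; omega
  have hp2 : p % 2 = 1 := by
    rcases (Fact.out : p.Prime).eq_two_or_odd with h | h <;> omega
  have h2 := two_zmod_ne_zero hp2
  have hTS := Tp2_eq_Sp2 ha hb hw hp hp2
  refine ⟨hTS.symm, ?_⟩
  have hsum := Tp2_add_Sp2 (p := p) (a := a) (b := b) (t := p - 1 - a) (s := p - 1 - b)
    (by omega) (by omega) (by omega) (by omega) hb hp2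
  rw [hTS, paritySum_mul_paritySum_eq_zero hp2 (by omega) (by omega) (by omega) (by omega)
      (by rw [Nat.odd_iff] at hw ⊢; omega) (by omega) (by omega),
    faulhaber_coeff _ ha (by omega) (by omega) (by omega) (by omega),
    faulhaber_coeff _ ha (by omega) (by omega) (by omega) (by omega),
    show p - 1 - b + 1 = p - b by omega, show p - b - a = p - (a + b) by omega,
    choose_sub_zmod hb (by omega), Nat.cast_sub (show b ≤ p by omega), ZMod.natCast_self, one_pow,
    inv_pow] at hsum
  have hpow : (2 : ZMod p) ^ (p - 1 - b) = (2 ^ b)⁻¹ := by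
    rw [← inv_pow, inv_pow_eq_pow_s11 h2 (t := p - 1 - b) (by omega)]
  have hchoose := congrArg (Nat.cast (R := ZMod p)) (Nat.choose_mul_succ_eq (a + b - 1) a)
  rw [show a + b - 1 + 1 = a + b by omega, show a + b - a = b by omega, Nat.cast_mul,
    Nat.cast_mul] at hchoose
  have hb0 : (b : ZMod p) ≠ 0 := natCast_zmod_ne_zero hb (by omega)
  have hw0 : ((a + b : ℕ) : ZMod p) ≠ 0 := natCast_zmod_ne_zero (by omega) hp
  rw [← eq_div_iff hw0] at hchoose
  rw [hpow, hchoose] at hsum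
  apply mul_left_cancel₀ h2
  rw [two_mul, hsum]
  field_simp
  ring
end

section
/- Let p ≥ 5 be a prime, let q_p be the Fermat quotient of 2, let ε = (−1)^{(p−1)/2}, and set G_p := −T_p(2̄) ∈ ℤ/pℤ. Then in ℤ/pℤ: T_p(1,1̄) = G_p/2, T_p(1̄,1) = −ε·G_p/2, S_p(2̄) = ε·G_p, S_p(1̄,1) = ε·q_p^2/2 − G_p/2, t_p(1,1̄) = −ε·q_p^2/8 + G_p/2, and ζ^{(2)}_p(1,1̄) = 3·q_p^2/8 − ε·G_p/2. -/
open Finset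

/-- The Fermat quotient of 2: the residue class mod `p` of `(2^{p-1} - 1)/p`. -/
def qp (p : ℕ) : ZMod p := (((2 ^ (p - 1) - 1) / p : ℕ) : ZMod p)

/-- `T_p(2̄) := ∑_{0<k<p, k odd} (-1)^{(k+1)/2}/k²` in `ℤ/pℤ`. -/
def Tpb2 (p : ℕ) : ZMod p :=
  ∑ k ∈ (Finset.Ioo 0 p).filter (fun k => k % 2 = 1),
    (-1 : ZMod p) ^ ((k + 1) / 2) * (((k : ZMod p)) ^ 2)⁻¹

/-- `S_p(2̄) := ∑_{0<k<p, k even} (-1)^{k/2}/k²` in `ℤ/pℤ`. -/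
def Spb2 (p : ℕ) : ZMod p :=
  ∑ k ∈ (Finset.Ioo 0 p).filter (fun k => k % 2 = 0),
    (-1 : ZMod p) ^ (k / 2) * (((k : ZMod p)) ^ 2)⁻¹

/-- `T_p(1,1̄)`: sum over `p > m > n > 0`, `m` even, `n` odd, of
`(-1)^{(n+1)/2}/(mn)` in `ℤ/pℤ`. -/
def Tp1b (p : ℕ) : ZMod p :=
  ∑ m ∈ (Finset.Ioo 0 p).filter (fun m => m % 2 = 0),
    ∑ n ∈ (Finset.Ioo 0 m).filter (fun n => n % 2 = 1),
      (-1 : ZMod p) ^ ((n + 1) / 2) * ((m : ZMod p) * (n : ZMod p))⁻¹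

/-- `T_p(1̄,1)`: sum over `p > m > n > 0`, `m` even, `n` odd, of
`(-1)^{m/2}/(mn)` in `ℤ/pℤ`. -/
def Tpb1 (p : ℕ) : ZMod p :=
  ∑ m ∈ (Finset.Ioo 0 p).filter (fun m => m % 2 = 0),
    ∑ n ∈ (Finset.Ioo 0 m).filter (fun n => n % 2 = 1),
      (-1 : ZMod p) ^ (m / 2) * ((m : ZMod p) * (n : ZMod p))⁻¹

/-- `S_p(1̄,1)`: sum over `p > m > n > 0`, `m` odd, `n` even, of
`(-1)^{(m+1)/2}/(mn)` in `ℤ/pℤ`. -/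
def Spb1 (p : ℕ) : ZMod p :=
  ∑ m ∈ (Finset.Ioo 0 p).filter (fun m => m % 2 = 1),
    ∑ n ∈ (Finset.Ioo 0 m).filter (fun n => n % 2 = 0),
      (-1 : ZMod p) ^ ((m + 1) / 2) * ((m : ZMod p) * (n : ZMod p))⁻¹

/-- `t_p(1,1̄)`: sum over `p > m > n > 0`, `m, n` both odd, of
`(-1)^{(n+1)/2}/(mn)` in `ℤ/pℤ`. -/
def tp1b (p : ℕ) : ZMod p :=
  ∑ m ∈ (Finset.Ioo 0 p).filter (fun m => m % 2 = 1),
    ∑ n ∈ (Finset.Ioo 0 m).filter (fun n => n % 2 = 1),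
      (-1 : ZMod p) ^ ((n + 1) / 2) * ((m : ZMod p) * (n : ZMod p))⁻¹

/-- `ζ^{(2)}_p(1,1̄)`: sum over `p > m > n > 0`, `m, n` both even, of
`(-1)^{n/2}/(mn)` in `ℤ/pℤ`. -/
def zeta2p1b (p : ℕ) : ZMod p :=
  ∑ m ∈ (Finset.Ioo 0 p).filter (fun m => m % 2 = 0),
    ∑ n ∈ (Finset.Ioo 0 m).filter (fun n => n % 2 = 0),
      (-1 : ZMod p) ^ (n / 2) * ((m : ZMod p) * (n : ZMod p))⁻¹

/-- The function `k ↦ Re (i ^ k)` with values in `ZMod p`. -/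
def evenSign (p k : ℕ) : ZMod p := if k % 2 = 0 then (-1) ^ (k / 2) else 0

/-- The function `k ↦ -Im (i ^ k)` with values in `ZMod p`. -/
def oddSign (p k : ℕ) : ZMod p := if k % 2 = 1 then (-1) ^ ((k + 1) / 2) else 0

/-- The indicator function of the even numbers with values in `ZMod p`. -/
def evenInd (p k : ℕ) : ZMod p := if k % 2 = 0 then 1 else 0

/-- The indicator function of the odd numbers with values in `ZMod p`. -/
def oddInd (p k : ℕ) : ZMod p := if k % 2 = 1 then 1 else 0

/-- The weighted harmonic sum `∑_{0<k<p} f(k)/k` in `ZMod p`. -/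
def harmSum (p : ℕ) (f : ℕ → ZMod p) : ZMod p :=
  ∑ k ∈ Ioo 0 p, f k * (k : ZMod p)⁻¹

/-- The weighted sum of squared inverses `∑_{0<k<p} f(k)/k²` in `ZMod p`. -/
def harmSum2 (p : ℕ) (f : ℕ → ZMod p) : ZMod p :=
  ∑ k ∈ Ioo 0 p, f k * ((k : ZMod p) ^ 2)⁻¹

/-- The weighted double harmonic sum `∑_{p>m>n>0} f(m)g(n)/(mn)` in `ZMod p`. -/
def doubleSum (p : ℕ) (f g : ℕ → ZMod p) : ZMod p :=
  ∑ m ∈ Ioo 0 p, ∑ n ∈ Ioo 0 m, f m * g n * ((m : ZMod p) * (n : ZMod p))⁻¹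

section Signs

variable (p : ℕ)

lemma neg_one_pow_eq_of_mod {p : ℕ} (k r : ℕ) (h : k % 2 = r) :
    (-1 : ZMod p) ^ k = (-1) ^ r := by
  rw [neg_one_pow_eq_pow_mod_two, h]

lemma evenSign_eq (k : ℕ) :
    evenSign p k = if k % 4 = 0 then 1 else if k % 4 = 2 then -1 else 0 := by
  unfold evenSign
  have h : k % 4 < 4 := Nat.mod_lt _ (by norm_num)
  interval_cases hk : k % 4
  · rw [if_pos (by omega), neg_one_pow_eq_of_mod _ 0 (by omega)]; simp
  · rw [if_neg (by omega)]; simp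
  · rw [if_pos (by omega), neg_one_pow_eq_of_mod _ 1 (by omega)]; simp
  · rw [if_neg (by omega)]; simp

lemma oddSign_eq (k : ℕ) :
    oddSign p k = if k % 4 = 1 then -1 else if k % 4 = 3 then 1 else 0 := by
  unfold oddSign
  have h : k % 4 < 4 := Nat.mod_lt _ (by norm_num)
  interval_cases hk : k % 4
  · rw [if_neg (by omega)]; simp
  · rw [if_pos (by omega), neg_one_pow_eq_of_mod _ 1 (by omega)]; simp
  · rw [if_neg (by omega)]; simp
  · rw [if_pos (by omega), neg_one_pow_eq_of_mod _ 0 (by omega)]; simp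

lemma evenInd_eq (k : ℕ) :
    evenInd p k = if k % 4 = 0 then 1 else if k % 4 = 2 then 1 else 0 := by
  unfold evenInd
  split_ifs <;> first | rfl | omega

lemma oddInd_eq (k : ℕ) :
    oddInd p k = if k % 4 = 1 then 1 else if k % 4 = 3 then 1 else 0 := by
  unfold oddInd
  split_ifs <;> first | rfl | omega

variable {p}

lemma evenSign_sub {m k : ℕ} (h : k ≤ m) :
    evenSign p (m - k) = evenSign p m * evenSign p k + oddSign p m * oddSign p k := by
  obtain ⟨j, rfl⟩ := Nat.exists_eq_add_of_le h
  simp only [evenSign_eq, oddSign_eq, Nat.add_sub_cancel_left, Nat.add_mod k j]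
  have hj : j % 4 < 4 := Nat.mod_lt _ (by norm_num)
  have hk : k % 4 < 4 := Nat.mod_lt _ (by norm_num)
  interval_cases j % 4 <;> interval_cases k % 4 <;> simp

lemma oddSign_sub {m k : ℕ} (h : k ≤ m) :
    oddSign p (m - k) = oddSign p m * evenSign p k - evenSign p m * oddSign p k := by
  obtain ⟨j, rfl⟩ := Nat.exists_eq_add_of_le h
  simp only [evenSign_eq, oddSign_eq, Nat.add_sub_cancel_left, Nat.add_mod k j]
  have hj : j % 4 < 4 := Nat.mod_lt _ (by norm_num)
  have hk : k % 4 < 4 := Nat.mod_lt _ (by norm_num)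
  interval_cases j % 4 <;> interval_cases k % 4 <;> simp

lemma evenInd_sub {m k : ℕ} (h : k ≤ m) :
    evenInd p (m - k) = evenInd p m * evenInd p k + oddInd p m * oddInd p k := by
  obtain ⟨j, rfl⟩ := Nat.exists_eq_add_of_le h
  simp only [evenInd_eq, oddInd_eq, Nat.add_sub_cancel_left, Nat.add_mod k j]
  have hj : j % 4 < 4 := Nat.mod_lt _ (by norm_num)
  have hk : k % 4 < 4 := Nat.mod_lt _ (by norm_num)
  interval_cases j % 4 <;> interval_cases k % 4 <;> simp

lemma oddInd_sub {m k : ℕ} (h : k ≤ m) :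
    oddInd p (m - k) = oddInd p m * evenInd p k + evenInd p m * oddInd p k := by
  obtain ⟨j, rfl⟩ := Nat.exists_eq_add_of_le h
  simp only [evenInd_eq, oddInd_eq, Nat.add_sub_cancel_left, Nat.add_mod k j]
  have hj : j % 4 < 4 := Nat.mod_lt _ (by norm_num)
  have hk : k % 4 < 4 := Nat.mod_lt _ (by norm_num)
  interval_cases j % 4 <;> interval_cases k % 4 <;> simp

lemma evenSign_mul_self (k : ℕ) : evenSign p k * evenSign p k = evenInd p k := by
  unfold evenSign evenInd
  split_ifs <;> simp [← mul_pow]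

lemma oddSign_mul_self (k : ℕ) : oddSign p k * oddSign p k = oddInd p k := by
  unfold oddSign oddInd
  split_ifs <;> simp [← mul_pow]

lemma evenSign_mul_oddSign (k : ℕ) : evenSign p k * oddSign p k = 0 := by
  unfold evenSign oddSign
  split_ifs <;> first | omega | simp

lemma evenSign_mul_evenInd (k : ℕ) : evenSign p k * evenInd p k = evenSign p k := by
  unfold evenSign evenInd
  split_ifs <;> simp

lemma evenSign_mul_oddInd (k : ℕ) : evenSign p k * oddInd p k = 0 := by
  unfold evenSign oddInd
  split_ifs <;> first | omega | simp

lemma oddSign_mul_evenInd (k : ℕ) : oddSign p k * evenInd p k = 0 := by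
  unfold oddSign evenInd
  split_ifs <;> first | omega | simp

lemma evenInd_add_oddInd (k : ℕ) : evenInd p k + oddInd p k = 1 := by
  unfold oddInd evenInd
  split_ifs <;> first | omega | simp

end Signs

lemma sum_Ioo_reflect {M : Type*} [AddCommMonoid M] (m : ℕ) (F : ℕ → M) :
    ∑ n ∈ Ioo 0 m, F (m - n) = ∑ n ∈ Ioo 0 m, F n := by
  refine sum_nbij' (fun n => m - n) (fun n => m - n) ?_ ?_ ?_ ?_ (fun _ _ => rfl) <;>
    simp only [mem_Ioo] <;> intro n hn <;> omega

lemma sum_Ioo_zero_succ {M : Type*} [AddCommMonoid M] {n : ℕ} (hn : 0 < n) (F : ℕ → M) :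
    ∑ k ∈ Ioo 0 (n + 1), F k = ∑ k ∈ Ioo 0 n, F k + F n := by
  have : Ioo 0 (n + 1) = insert n (Ioo 0 n) := by
    ext k; simp only [mem_Ioo, mem_insert]; omega
  rw [this, sum_insert (by simp), add_comm]

lemma sum_Ioo_mul_sum_Ioo {R : Type*} [CommRing R] (N : ℕ) (a b : ℕ → R) :
    (∑ k ∈ Ioo 0 N, a k) * ∑ k ∈ Ioo 0 N, b k =
      ∑ m ∈ Ioo 0 N, ∑ n ∈ Ioo 0 m, a m * b n + ∑ m ∈ Ioo 0 N, ∑ n ∈ Ioo 0 m, b m * a n +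
        ∑ k ∈ Ioo 0 N, a k * b k := by
  induction N with
  | zero => simp
  | succ N ih =>
    rcases Nat.eq_zero_or_pos N with rfl | hN
    · simp [show Ioo 0 1 = (∅ : Finset ℕ) from rfl]
    · simp only [sum_Ioo_zero_succ hN, ← mul_sum] at ih ⊢
      linear_combination ih

lemma sum_Ioo_two_mul_add_one {M : Type*} [AddCommMonoid M] (N : ℕ) (F : ℕ → M) :
    ∑ k ∈ Ioo 0 (2 * N + 1), F k = ∑ j ∈ range N, (F (2 * j + 1) + F (2 * j + 2)) := by
  induction N with
  | zero => rfl
  | succ N ih =>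
    rw [sum_range_succ, ← ih, show 2 * (N + 1) + 1 = 2 * N + 1 + 1 + 1 by ring,
      sum_Ioo_zero_succ (by omega), sum_Ioo_zero_succ (by omega), add_assoc]

lemma sum_Ioo_two_mul_add_one_reflect {M : Type*} [AddCommMonoid M] (N : ℕ) (F : ℕ → M) :
    ∑ k ∈ Ioo 0 (2 * N + 1), F k =
      ∑ j ∈ range N, (F (j + 1) + F (2 * N + 1 - (j + 1))) := by
  have h : ∑ k ∈ Ioo 0 (2 * N + 1), F k = ∑ k ∈ range (N + N), F (k + 1) := by
    refine sum_nbij' (fun k => k - 1) (fun k => k + 1) ?_ ?_ ?_ ?_ ?_ <;>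
      simp only [mem_Ioo, mem_range] <;> intro k hk
    · omega
    · omega
    · omega
    · omega
    · rw [Nat.sub_add_cancel hk.1]
  rw [h, sum_range_add, sum_add_distrib, ← sum_range_reflect (fun x => F (N + x + 1))]
  congr 1
  refine sum_congr rfl fun j hj => ?_
  rw [mem_range] at hj
  congr 1
  omega

section Sums

variable {p : ℕ}

lemma natCast_ne_zero_of_mem_Ioo {k : ℕ} (hk : k ∈ Ioo 0 p) : (k : ZMod p) ≠ 0 := by
  rw [mem_Ioo] at hk
  rw [Ne, ZMod.natCast_eq_zero_iff]
  exact fun h => absurd (Nat.le_of_dvd hk.1 h) (by omega)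

lemma natCast_sub_self {k : ℕ} (hk : k ≤ p) : ((p - k : ℕ) : ZMod p) = -k := by
  rw [Nat.cast_sub hk]; simp

lemma doubleSum_eq_swap (f g : ℕ → ZMod p) :
    ∑ m ∈ Ioo 0 p, ∑ n ∈ Ioo 0 m, f n * g (p - m) * ((n : ZMod p) * ((p - m : ℕ) : ZMod p))⁻¹ =
    ∑ m ∈ Ioo 0 p, ∑ n ∈ Ioo 0 m, f n * g (m - n) * ((n : ZMod p) * ((m - n : ℕ) : ZMod p))⁻¹ := by
  rw [sum_sigma', sum_sigma']
  refine sum_nbij' (fun x => ⟨p - x.1 + x.2, x.2⟩) (fun x => ⟨p - x.1 + x.2, x.2⟩)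
    ?_ ?_ ?_ ?_ ?_ <;> simp only [mem_sigma, mem_Ioo] <;> rintro ⟨m, n⟩ h <;> simp only at h ⊢
  · omega
  · omega
  · congr 1; omega
  · congr 1; omega
  · rw [Nat.add_sub_cancel]

variable [Fact p.Prime]

/-- The partial fraction (shuffle) relation for double harmonic sums modulo `p`. -/
lemma doubleSum_shuffle (f g : ℕ → ZMod p) :
    doubleSum p (fun m => - g (p - m)) f =
      ∑ m ∈ Ioo 0 p, ∑ n ∈ Ioo 0 m,
        (f n * g (m - n) + f (m - n) * g n) * ((m : ZMod p) * (n : ZMod p))⁻¹ := by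
  have key : ∀ m ∈ Ioo 0 p,
      ∑ n ∈ Ioo 0 m, f n * g (m - n) * ((n : ZMod p) * ((m - n : ℕ) : ZMod p))⁻¹ =
      ∑ n ∈ Ioo 0 m,
        (f n * g (m - n) + f (m - n) * g n) * ((m : ZMod p) * (n : ZMod p))⁻¹ := by
    intro m hm
    simp only [add_mul, sum_add_distrib]
    rw [← sum_Ioo_reflect m (fun n => f (m - n) * g n * ((m : ZMod p) * (n : ZMod p))⁻¹),
      ← sum_add_distrib]
    refine sum_congr rfl fun n hn => ?_
    have hm0 := natCast_ne_zero_of_mem_Ioo hm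
    rw [mem_Ioo] at hm hn
    have hn0 : (n : ZMod p) ≠ 0 := natCast_ne_zero_of_mem_Ioo (mem_Ioo.2 (by omega))
    have hmn0 : ((m - n : ℕ) : ZMod p) ≠ 0 := natCast_ne_zero_of_mem_Ioo (mem_Ioo.2 (by omega))
    rw [Nat.sub_sub_self hn.2.le]
    have hcast : (m : ZMod p) = ((m - n : ℕ) : ZMod p) + n := by
      rw [← Nat.cast_add, Nat.sub_add_cancel hn.2.le]
    generalize ((m - n : ℕ) : ZMod p) = d at *
    rw [hcast] at hm0 ⊢
    field_simp
  rw [← sum_congr rfl key, ← doubleSum_eq_swap]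
  refine sum_congr rfl fun m hm => sum_congr rfl fun n hn => ?_
  rw [mem_Ioo] at hm
  rw [natCast_sub_self hm.2.le, mul_neg, inv_neg, mul_comm (n : ZMod p)]
  ring

/-- Reversal of double harmonic sums modulo `p`. -/
lemma doubleSum_reverse (f g : ℕ → ZMod p) :
    doubleSum p f g = doubleSum p (fun m => g (p - m)) (fun n => f (p - n)) := by
  unfold doubleSum
  rw [sum_sigma', sum_sigma']
  refine sum_nbij' (fun x => ⟨p - x.2, p - x.1⟩) (fun x => ⟨p - x.2, p - x.1⟩)
    ?_ ?_ ?_ ?_ ?_ <;> simp only [mem_sigma, mem_Ioo] <;> rintro ⟨m, n⟩ h <;> simp only at h ⊢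
  · omega
  · omega
  · congr 1 <;> omega
  · congr 1 <;> omega
  · rw [natCast_sub_self (by omega), natCast_sub_self (by omega), Nat.sub_sub_self (by omega),
      Nat.sub_sub_self (by omega), neg_mul_neg, mul_comm (n : ZMod p), mul_comm (f m)]

/-- The stuffle relation for double harmonic sums modulo `p`. -/
lemma harmSum_mul_harmSum (f g : ℕ → ZMod p) :
    harmSum p f * harmSum p g =
      doubleSum p f g + doubleSum p g f + harmSum2 p (fun k => f k * g k) := by
  have h1 : doubleSum p f g = ∑ m ∈ Ioo 0 p, ∑ n ∈ Ioo 0 m,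
      (f m * (m : ZMod p)⁻¹) * (g n * (n : ZMod p)⁻¹) :=
    sum_congr rfl fun m _ => sum_congr rfl fun n _ => by rw [mul_inv]; ring
  have h2 : doubleSum p g f = ∑ m ∈ Ioo 0 p, ∑ n ∈ Ioo 0 m,
      (g m * (m : ZMod p)⁻¹) * (f n * (n : ZMod p)⁻¹) :=
    sum_congr rfl fun m _ => sum_congr rfl fun n _ => by rw [mul_inv]; ring
  have h3 : harmSum2 p (fun k => f k * g k) = ∑ k ∈ Ioo 0 p,
      (f k * (k : ZMod p)⁻¹) * (g k * (k : ZMod p)⁻¹) :=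
    sum_congr rfl fun k _ => by rw [sq, mul_inv]; ring
  rw [h1, h2, h3, harmSum, harmSum, sum_Ioo_mul_sum_Ioo]

lemma harmSum_reverse (f : ℕ → ZMod p) :
    harmSum p f = - harmSum p (fun k => f (p - k)) := by
  unfold harmSum
  rw [← sum_Ioo_reflect, ← sum_neg_distrib]
  refine sum_congr rfl fun k hk => ?_
  rw [natCast_sub_self (mem_Ioo.1 hk).2.le, inv_neg, mul_neg]

lemma harmSum2_reverse (f : ℕ → ZMod p) :
    harmSum2 p f = harmSum2 p (fun k => f (p - k)) := by
  unfold harmSum2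
  rw [← sum_Ioo_reflect]
  refine sum_congr rfl fun k hk => ?_
  rw [natCast_sub_self (mem_Ioo.1 hk).2.le, neg_sq]

lemma natCast_choose_sub_one {k : ℕ} (hk : k < p) :
    (((p - 1).choose k : ℕ) : ZMod p) = (-1) ^ k := by
  induction k with
  | zero => simp
  | succ k ih =>
    have h := Nat.choose_succ_succ (p - 1) k
    have hp := (Fact.out : p.Prime)
    rw [Nat.succ_eq_add_one, Nat.sub_add_cancel hp.pos] at h
    have h0 : ((p.choose (k + 1) : ℕ) : ZMod p) = 0 :=
      (ZMod.natCast_eq_zero_iff _ _).2 (hp.dvd_choose_self (by omega) hk)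
    rw [h, Nat.cast_add, ih (by omega)] at h0
    rw [pow_succ]
    linear_combination h0

lemma natCast_choose_div {k : ℕ} (hk : k ∈ Ioo 0 p) :
    ((p.choose k / p : ℕ) : ZMod p) = (-1) ^ (k - 1) * (k : ZMod p)⁻¹ := by
  have hp := (Fact.out : p.Prime)
  have hk0 := natCast_ne_zero_of_mem_Ioo hk
  rw [mem_Ioo] at hk
  obtain ⟨c, hc⟩ := hp.dvd_choose_self (by omega) hk.2
  have h := Nat.add_one_mul_choose_eq (p - 1) (k - 1)
  rw [Nat.sub_add_cancel hp.pos, Nat.sub_add_cancel hk.1, hc, mul_assoc] at h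
  have h' := Nat.eq_of_mul_eq_mul_left hp.pos h
  rw [hc, Nat.mul_div_cancel_left _ hp.pos, ← natCast_choose_sub_one (by omega), h', Nat.cast_mul,
    mul_assoc, mul_inv_cancel₀ hk0, mul_one]

lemma two_mul_qp (hp2 : p ≠ 2) : 2 * qp p = harmSum p (fun k => (-1) ^ (k - 1)) := by
  have hp := (Fact.out : p.Prime)
  have hdvd : p ∣ 2 ^ (p - 1) - 1 := by
    have h2 : (2 : ZMod p) ≠ 0 := by
      intro h
      have : ((2 : ℕ) : ZMod p) = 0 := by exact_mod_cast h
      rw [ZMod.natCast_eq_zero_iff] at this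
      exact hp2 ((Nat.prime_dvd_prime_iff_eq hp Nat.prime_two).1 this)
    rw [← ZMod.natCast_eq_zero_iff, Nat.cast_sub Nat.one_le_two_pow]
    push_cast
    rw [ZMod.pow_card_sub_one_eq_one h2, sub_self]
  obtain ⟨c, hc⟩ := hdvd
  have hsum : ∑ k ∈ Ioo 0 p, p.choose k = p * (2 * c) := by
    have h1 := Nat.sum_range_choose p
    have h2 : ∑ k ∈ range (p + 1), p.choose k = 1 + ∑ k ∈ Ioo 0 p, p.choose k + 1 := by
      rw [sum_range_succ, Nat.choose_self, range_eq_Ico, ← Ioo_insert_left hp.pos,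
        sum_insert (by simp), Nat.choose_zero_right]
    have h3 : 2 ^ p = 2 * 2 ^ (p - 1) := by
      rw [← pow_succ', Nat.sub_add_cancel hp.pos]
    have h4 : 1 ≤ 2 ^ (p - 1) := Nat.one_le_two_pow
    have h5 : p * (2 * c) = 2 * (p * c) := by ring
    omega
  have hdiv : ∑ k ∈ Ioo 0 p, p.choose k / p = 2 * c := by
    refine Nat.eq_of_mul_eq_mul_left hp.pos ?_
    rw [← hsum, mul_sum]
    refine sum_congr rfl fun k hk => ?_
    rw [mem_Ioo] at hk
    exact Nat.mul_div_cancel' (hp.dvd_choose_self (by omega) hk.2)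
  rw [qp, hc, Nat.mul_div_cancel_left _ hp.pos]
  calc (2 : ZMod p) * (c : ZMod p) = ((2 * c : ℕ) : ZMod p) := by push_cast; rfl
    _ = _ := by
      rw [← hdiv, Nat.cast_sum]
      exact sum_congr rfl fun k hk => natCast_choose_div hk

end Sums

section Odd

variable {p : ℕ} [Fact p.Prime]

lemma two_ne_zero_of_odd (hodd : p % 2 = 1) : (2 : ZMod p) ≠ 0 := by
  have : Fact (2 < p) := ⟨by have := (Fact.out : p.Prime).two_le; omega⟩
  exact Ring.two_ne_zero (by rw [ZMod.ringChar_zmod_n]; omega)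

lemma harmSum_oddInd (hodd : p % 2 = 1) : harmSum p (oddInd p) = - harmSum p (evenInd p) := by
  rw [harmSum_reverse]
  congr 1
  refine sum_congr rfl fun k hk => ?_
  simp only [oddInd_sub (mem_Ioo.1 hk).2.le]
  simp [oddInd, evenInd, hodd]

lemma harmSum_neg_one_pow (hodd : p % 2 = 1) :
    harmSum p (fun k => (-1) ^ k) = 2 * harmSum p (evenInd p) := by
  have h : harmSum p (fun k => (-1) ^ k) = harmSum p (evenInd p) - harmSum p (oddInd p) := by
    simp only [harmSum, ← sum_sub_distrib, ← sub_mul]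
    refine sum_congr rfl fun k _ => ?_
    congr 1
    rw [neg_one_pow_eq_pow_mod_two, evenInd, oddInd]
    rcases Nat.mod_two_eq_zero_or_one k with h | h <;> simp [h]
  rw [h, harmSum_oddInd hodd]
  ring

lemma harmSum_evenInd (hodd : p % 2 = 1) : harmSum p (evenInd p) = - qp p := by
  have h : harmSum p (fun k => (-1) ^ (k - 1)) = - harmSum p (fun k => (-1) ^ k) := by
    rw [harmSum, harmSum, ← sum_neg_distrib]
    refine sum_congr rfl fun k hk => ?_
    obtain ⟨j, rfl⟩ := Nat.exists_eq_add_of_lt (mem_Ioo.1 hk).1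
    simp [pow_succ]
  have h2 := two_mul_qp (p := p) (by omega)
  rw [h, harmSum_neg_one_pow hodd] at h2
  refine mul_left_cancel₀ (two_ne_zero_of_odd hodd) ?_
  linear_combination h2

lemma two_mul_harmSum_evenSign (hodd : p % 2 = 1) :
    2 * harmSum p (evenSign p) = harmSum p (evenInd p) := by
  have h2 := two_ne_zero_of_odd hodd
  obtain ⟨N, hN⟩ : ∃ N, p = 2 * N + 1 := ⟨p / 2, by omega⟩
  have hA : 2 * harmSum p (evenSign p) =
      ∑ j ∈ range N, (-1) ^ (j + 1) * ((j + 1 : ℕ) : ZMod p)⁻¹ := by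
    have : Ioo 0 p = Ioo 0 (2 * N + 1) := by rw [← hN]
    rw [harmSum, this, sum_Ioo_two_mul_add_one, mul_sum]
    refine sum_congr rfl fun j _ => ?_
    have e1 : evenSign p (2 * j + 1) = 0 := if_neg (by omega)
    have e2 : evenSign p (2 * j + 2) = (-1) ^ (j + 1) := by
      rw [evenSign, if_pos (by omega)]; congr 1; omega
    have e3 : ((2 * j + 2 : ℕ) : ZMod p) = 2 * ((j + 1 : ℕ) : ZMod p) := by push_cast; ring
    rw [e1, e2, e3, mul_inv]
    field_simp
    ring
  have hB : harmSum p (fun k => (-1) ^ k) =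
      2 * ∑ j ∈ range N, (-1) ^ (j + 1) * ((j + 1 : ℕ) : ZMod p)⁻¹ := by
    have : Ioo 0 p = Ioo 0 (2 * N + 1) := by rw [← hN]
    rw [harmSum, this, sum_Ioo_two_mul_add_one_reflect, mul_sum, ← hN]
    refine sum_congr rfl fun j hj => ?_
    rw [mem_range] at hj
    rw [natCast_sub_self (by omega), neg_one_pow_eq_pow_mod_two,
      neg_one_pow_eq_pow_mod_two (n := p - (j + 1)), inv_neg]
    rcases Nat.mod_two_eq_zero_or_one (j + 1) with h | h
    · rw [show (p - (j + 1)) % 2 = 1 by omega, h]; ring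
    · rw [show (p - (j + 1)) % 2 = 0 by omega, h]; ring
  refine mul_left_cancel₀ h2 ?_
  rw [← harmSum_neg_one_pow hodd, hB, hA]

lemma oddSign_self (hodd : p % 2 = 1) : oddSign p p = - (-1) ^ ((p - 1) / 2) := by
  rw [oddSign, if_pos hodd, show (p + 1) / 2 = (p - 1) / 2 + 1 by omega, pow_succ]
  ring

lemma evenSign_self (hodd : p % 2 = 1) : evenSign p p = 0 := if_neg (by omega)

lemma harmSum2_evenInd (hp : 5 ≤ p) : harmSum2 p (evenInd p) = 0 := by
  have hodd : p % 2 = 1 :=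
    ((Fact.out : p.Prime).eq_two_or_odd).resolve_left (by omega)
  have h2 := two_ne_zero_of_odd hodd
  have h3 : (3 : ZMod p) ≠ 0 := by
    exact_mod_cast natCast_ne_zero_of_mem_Ioo (p := p) (k := 3) (mem_Ioo.2 (by omega))
  obtain ⟨N, hN⟩ : ∃ N, p = 2 * N + 1 := ⟨p / 2, by omega⟩
  have hI : Ioo 0 p = Ioo 0 (2 * N + 1) := by rw [← hN]
  have hO : harmSum2 p (oddInd p) = harmSum2 p (evenInd p) := by
    rw [harmSum2_reverse]
    refine sum_congr rfl fun k hk => ?_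
    simp only [oddInd_sub (mem_Ioo.1 hk).2.le]
    simp [oddInd, evenInd, hodd]
  have hA : 4 * harmSum2 p (evenInd p) = ∑ j ∈ range N, (((j + 1 : ℕ) : ZMod p) ^ 2)⁻¹ := by
    rw [harmSum2, hI, sum_Ioo_two_mul_add_one, mul_sum]
    refine sum_congr rfl fun j _ => ?_
    have e1 : evenInd p (2 * j + 1) = 0 := if_neg (by omega)
    have e2 : evenInd p (2 * j + 2) = 1 := if_pos (by omega)
    have e3 : ((2 * j + 2 : ℕ) : ZMod p) = 2 * ((j + 1 : ℕ) : ZMod p) := by push_cast; ring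
    rw [e1, e2, e3, mul_pow, mul_inv]
    field_simp
    ring
  have hB : harmSum2 p (oddInd p) + harmSum2 p (evenInd p) =
      2 * ∑ j ∈ range N, (((j + 1 : ℕ) : ZMod p) ^ 2)⁻¹ := by
    have : harmSum2 p (oddInd p) + harmSum2 p (evenInd p) =
        ∑ k ∈ Ioo 0 p, ((k : ZMod p) ^ 2)⁻¹ := by
      simp only [harmSum2, ← sum_add_distrib, ← add_mul]
      refine sum_congr rfl fun k _ => ?_
      rw [add_comm, evenInd_add_oddInd, one_mul]
    rw [this, hI, sum_Ioo_two_mul_add_one_reflect, mul_sum, ← hN]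
    refine sum_congr rfl fun j hj => ?_
    rw [mem_range] at hj
    rw [natCast_sub_self (by omega), neg_sq]
    ring
  rw [hO] at hB
  refine mul_left_cancel₀ h2 (mul_left_cancel₀ h3 ?_)
  linear_combination 2 * hA - hB

end Odd

section Eval

variable {p : ℕ}

lemma sum_filter_sum_filter_eq_doubleSum {P Q : ℕ → Prop} [DecidablePred P] [DecidablePred Q]
    (f g : ℕ → ZMod p) :
    doubleSum p (fun m => if P m then f m else 0) (fun n => if Q n then g n else 0) =
      ∑ m ∈ (Ioo 0 p).filter P, ∑ n ∈ (Ioo 0 m).filter Q,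
        f m * g n * ((m : ZMod p) * (n : ZMod p))⁻¹ := by
  simp only [doubleSum, sum_filter]
  refine sum_congr rfl fun m _ => ?_
  split_ifs
  · refine sum_congr rfl fun n _ => ?_
    split_ifs <;> simp
  · simp

lemma Tp1b_eq : Tp1b p = doubleSum p (evenInd p) (oddSign p) := by
  unfold evenInd oddSign
  simp only [sum_filter_sum_filter_eq_doubleSum, Tp1b, one_mul]

lemma Tpb1_eq : Tpb1 p = doubleSum p (evenSign p) (oddInd p) := by
  unfold evenSign oddInd
  simp only [sum_filter_sum_filter_eq_doubleSum, Tpb1, mul_one]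

lemma Spb1_eq : Spb1 p = doubleSum p (oddSign p) (evenInd p) := by
  unfold oddSign evenInd
  simp only [sum_filter_sum_filter_eq_doubleSum, Spb1, mul_one]

lemma tp1b_eq : tp1b p = doubleSum p (oddInd p) (oddSign p) := by
  unfold oddInd oddSign
  simp only [sum_filter_sum_filter_eq_doubleSum, tp1b, one_mul]

lemma zeta2p1b_eq : zeta2p1b p = doubleSum p (evenInd p) (evenSign p) := by
  unfold evenInd evenSign
  simp only [sum_filter_sum_filter_eq_doubleSum, zeta2p1b, one_mul]

lemma Tpb2_eq : Tpb2 p = harmSum2 p (oddSign p) := by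
  simp only [Tpb2, harmSum2, oddSign, sum_filter, ite_mul, zero_mul]

lemma Spb2_eq : Spb2 p = harmSum2 p (evenSign p) := by
  simp only [Spb2, harmSum2, evenSign, sum_filter, ite_mul, zero_mul]

lemma doubleSum_congr {f f' g g' : ℕ → ZMod p} (hf : ∀ m ∈ Ioo 0 p, f m = f' m)
    (hg : ∀ n ∈ Ioo 0 p, g n = g' n) : doubleSum p f g = doubleSum p f' g' := by
  refine sum_congr rfl fun m hm => sum_congr rfl fun n hn => ?_
  rw [hf m hm, hg n (by rw [mem_Ioo] at *; omega)]

lemma doubleSum_smul_left (c : ZMod p) (f g : ℕ → ZMod p) :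
    doubleSum p (fun m => c * f m) g = c * doubleSum p f g := by
  simp only [doubleSum, mul_sum, mul_assoc]

lemma doubleSum_smul_right (c : ZMod p) (f g : ℕ → ZMod p) :
    doubleSum p f (fun n => c * g n) = c * doubleSum p f g := by
  simp only [doubleSum, mul_sum]
  exact sum_congr rfl fun m _ => sum_congr rfl fun n _ => by ring

variable [Fact p.Prime]

lemma evenSign_reflect (hodd : p % 2 = 1) {k : ℕ} (hk : k ≤ p) :
    evenSign p (p - k) = oddSign p p * oddSign p k := by
  rw [evenSign_sub hk, evenSign_self hodd]; ring

lemma oddSign_reflect (hodd : p % 2 = 1) {k : ℕ} (hk : k ≤ p) :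
    oddSign p (p - k) = oddSign p p * evenSign p k := by
  rw [oddSign_sub hk, evenSign_self hodd]; ring

lemma evenInd_reflect (hodd : p % 2 = 1) {k : ℕ} (hk : k ≤ p) : evenInd p (p - k) = oddInd p k := by
  rw [evenInd_sub hk]; simp [evenInd, oddInd, hodd]

lemma oddInd_reflect (hodd : p % 2 = 1) {k : ℕ} (hk : k ≤ p) : oddInd p (p - k) = evenInd p k := by
  rw [oddInd_sub hk]; simp [evenInd, oddInd, hodd]

/-- Reversal of `T_p(1,1̄)`. -/
lemma doubleSum_evenInd_oddSign (hodd : p % 2 = 1) :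
    doubleSum p (evenInd p) (oddSign p) =
      oddSign p p * doubleSum p (evenSign p) (oddInd p) := by
  rw [doubleSum_reverse, ← doubleSum_smul_left]
  exact doubleSum_congr (fun m hm => oddSign_reflect hodd (mem_Ioo.1 hm).2.le)
    (fun n hn => evenInd_reflect hodd (mem_Ioo.1 hn).2.le)

/-- Reversal of `t_p(1,1̄)`. -/
lemma doubleSum_oddInd_oddSign (hodd : p % 2 = 1) :
    doubleSum p (oddInd p) (oddSign p) =
      oddSign p p * doubleSum p (evenSign p) (evenInd p) := by
  rw [doubleSum_reverse, ← doubleSum_smul_left]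
  exact doubleSum_congr (fun m hm => oddSign_reflect hodd (mem_Ioo.1 hm).2.le)
    (fun n hn => oddInd_reflect hodd (mem_Ioo.1 hn).2.le)

/-- The partial fraction relation for the pair `evenSign, evenSign`. -/
lemma doubleSum_shuffle_evenSign_evenSign (hodd : p % 2 = 1) :
    - oddSign p p * doubleSum p (oddSign p) (evenSign p) =
      2 * doubleSum p (evenSign p) (evenInd p) := by
  have h := doubleSum_shuffle (evenSign p) (evenSign p)
  rw [← doubleSum_smul_left, ← doubleSum_smul_right]
  convert h using 1
  · refine doubleSum_congr (fun m hm => ?_) fun _ _ => rfl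
    rw [evenSign_reflect hodd (mem_Ioo.1 hm).2.le, neg_mul]
  · refine sum_congr rfl fun m _ => sum_congr rfl fun n hn => ?_
    congr 1
    rw [evenSign_sub (mem_Ioo.1 hn).2.le]
    linear_combination (-2 * evenSign p m) * evenSign_mul_self (p := p) n -
      2 * oddSign p m * evenSign_mul_oddSign (p := p) n

/-- The partial fraction relation for the pair `oddSign, oddSign`. -/
lemma doubleSum_shuffle_oddSign_oddSign (hodd : p % 2 = 1) :
    - oddSign p p * doubleSum p (evenSign p) (oddSign p) =
      -2 * doubleSum p (evenSign p) (oddInd p) := by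
  have h := doubleSum_shuffle (oddSign p) (oddSign p)
  rw [← doubleSum_smul_left, ← doubleSum_smul_right]
  convert h using 1
  · refine doubleSum_congr (fun m hm => ?_) fun _ _ => rfl
    rw [oddSign_reflect hodd (mem_Ioo.1 hm).2.le, neg_mul]
  · refine sum_congr rfl fun m _ => sum_congr rfl fun n hn => ?_
    congr 1
    rw [oddSign_sub (mem_Ioo.1 hn).2.le]
    linear_combination (2 * evenSign p m) * oddSign_mul_self (p := p) n -
      2 * oddSign p m * evenSign_mul_oddSign (p := p) n

/-- The partial fraction relation for the pair `evenInd, evenSign`. -/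
lemma doubleSum_shuffle_evenInd_evenSign (hodd : p % 2 = 1) :
    - oddSign p p * doubleSum p (oddSign p) (evenInd p) =
      doubleSum p (evenSign p) (evenSign p) + doubleSum p (evenInd p) (evenSign p) := by
  have h := doubleSum_shuffle (evenInd p) (evenSign p)
  rw [← doubleSum_smul_left]
  convert h using 1
  · refine doubleSum_congr (fun m hm => ?_) fun _ _ => rfl
    rw [evenSign_reflect hodd (mem_Ioo.1 hm).2.le, neg_mul]
  · simp only [doubleSum, ← sum_add_distrib, ← add_mul]
    refine sum_congr rfl fun m _ => sum_congr rfl fun n hn => ?_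
    congr 1
    rw [evenSign_sub (mem_Ioo.1 hn).2.le, evenInd_sub (mem_Ioo.1 hn).2.le]
    linear_combination (-evenSign p m) * evenSign_mul_evenInd (p := p) n -
      oddSign p m * oddSign_mul_evenInd (p := p) n -
      evenInd p m * evenSign_mul_evenInd (p := p) n - oddInd p m * evenSign_mul_oddInd (p := p) n

lemma harmSum_oddSign (hodd : p % 2 = 1) :
    harmSum p (oddSign p) = - oddSign p p * harmSum p (evenSign p) := by
  rw [harmSum_reverse, neg_mul, harmSum, harmSum, mul_sum]
  congr 1
  refine sum_congr rfl fun k hk => ?_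
  rw [oddSign_reflect hodd (mem_Ioo.1 hk).2.le, mul_assoc]

lemma harmSum2_evenSign (hodd : p % 2 = 1) :
    harmSum2 p (evenSign p) = oddSign p p * harmSum2 p (oddSign p) := by
  rw [harmSum2_reverse, harmSum2, harmSum2, mul_sum]
  refine sum_congr rfl fun k hk => ?_
  rw [evenSign_reflect hodd (mem_Ioo.1 hk).2.le, mul_assoc]

end Eval

/-- For a prime `p ≥ 5`, with `ε = (-1)^{(p-1)/2}` and `G_p = -T_p(2̄)`, in `ℤ/pℤ`:
`T_p(1,1̄) = G_p/2`, `T_p(1̄,1) = -εG_p/2`, `S_p(2̄) = εG_p`,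
`S_p(1̄,1) = εq_p²/2 - G_p/2`, `t_p(1,1̄) = -εq_p²/8 + G_p/2`, and
`ζ^{(2)}_p(1,1̄) = 3q_p²/8 - εG_p/2`. -/
theorem stmt16 (p : ℕ) [Fact p.Prime] (hp : 5 ≤ p)
    (ε : ZMod p) (hε : ε = (-1 : ZMod p) ^ ((p - 1) / 2))
    (G : ZMod p) (hG : G = - Tpb2 p) :
    Tp1b p = G / 2 ∧
    Tpb1 p = - ε * G / 2 ∧
    Spb2 p = ε * G ∧
    Spb1 p = ε * qp p ^ 2 / 2 - G / 2 ∧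
    tp1b p = - ε * qp p ^ 2 / 8 + G / 2 ∧
    zeta2p1b p = 3 * qp p ^ 2 / 8 - ε * G / 2 := by
  have hodd : p % 2 = 1 :=
    ((Fact.out : p.Prime).eq_two_or_odd).resolve_left (by omega)
  have h2 := two_ne_zero_of_odd hodd
  have h8 : (8 : ZMod p) ≠ 0 := by
    have h : (8 : ZMod p) = 2 ^ 3 := by norm_num
    exact h ▸ pow_ne_zero 3 h2
  have hεε : ε * ε = 1 := by rw [hε, ← mul_pow]; simp
  have hσ : oddSign p p = -ε := by rw [oddSign_self hodd, hε]
  have hE := harmSum_evenInd hodd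
  have hH := two_mul_harmSum_evenSign hodd
  have hO := harmSum_oddSign hodd
  have hS := harmSum2_evenSign hodd
  have hSq := harmSum2_evenInd hp
  have rT := doubleSum_evenInd_oddSign hodd
  have rt := doubleSum_oddInd_oddSign hodd
  have sh1 := doubleSum_shuffle_evenSign_evenSign hodd
  have sh2 := doubleSum_shuffle_oddSign_oddSign hodd
  have sh3 := doubleSum_shuffle_evenInd_evenSign hodd
  have st1 := harmSum_mul_harmSum (evenSign p) (evenSign p)
  have st2 := harmSum_mul_harmSum (evenSign p) (oddSign p)
  have st3 := harmSum_mul_harmSum (evenSign p) (evenInd p)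
  have st4 := harmSum_mul_harmSum (oddSign p) (evenInd p)
  simp only [evenSign_mul_self, evenSign_mul_oddSign, evenSign_mul_evenInd,
    oddSign_mul_evenInd] at st1 st2 st3 st4
  have hz : harmSum2 p (fun _ => 0) = 0 := by simp [harmSum2]
  have hSq' : harmSum2 p (fun k => evenInd p k) = 0 := hSq
  have hS' : harmSum2 p (fun k => evenSign p k) = harmSum2 p (evenSign p) := rfl
  rw [hz] at st2 st4
  rw [hSq'] at st1
  rw [hS'] at st3
  rw [Tp1b_eq, Tpb1_eq, Spb2_eq, Spb1_eq, tp1b_eq, zeta2p1b_eq]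
  rw [Tpb2_eq] at hG
  rw [hσ] at hO hS rT rt sh1 sh2 sh3
  rw [hE] at hH st3 st4
  generalize harmSum p (evenSign p) = H at *
  generalize harmSum p (oddSign p) = O at *
  generalize harmSum2 p (evenSign p) = S at *
  generalize harmSum2 p (oddSign p) = T at *
  generalize doubleSum p (evenSign p) (evenInd p) = a at *
  generalize doubleSum p (evenSign p) (oddInd p) = b at *
  generalize doubleSum p (evenInd p) (oddSign p) = c at *
  generalize doubleSum p (oddSign p) (evenInd p) = d at *
  generalize doubleSum p (oddInd p) (oddSign p) = e at *
  generalize doubleSum p (evenInd p) (evenSign p) = f at *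
  generalize doubleSum p (evenSign p) (oddSign p) = x at *
  generalize doubleSum p (oddSign p) (evenSign p) = y at *
  generalize doubleSum p (evenSign p) (evenSign p) = z at *
  generalize qp p = q at *
  have hS2 : S = ε * G := by rw [hS, hG]; ring
  have hy : y = 2 * ε * a := by linear_combination ε * sh1 - y * hεε
  have hx : x = -2 * ε * b := by linear_combination ε * sh2 - x * hεε
  have hq : q = -2 * H := by linear_combination hH
  subst hq hy hx hO hS2 rT rt
  have hd : d = 2 * ε * H ^ 2 + ε * b := by linear_combination -st4
  have hf : f = 2 * H ^ 2 - ε * G - a := by linear_combination -st3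
  have hz2 : 2 * z = H ^ 2 := by linear_combination -st1
  have hab : 2 * (a - b) = H ^ 2 := by
    linear_combination (H ^ 2 - 2 * a + 2 * b) * hεε - ε * st2
  subst hd hf
  have hab' : 2 * (a + b) = H ^ 2 - 2 * ε * G := by
    linear_combination 2 * sh3 + hz2 - (4 * H ^ 2 + 2 * b) * hεε
  have ha : 2 * a = H ^ 2 - ε * G := by
    refine mul_left_cancel₀ h2 ?_
    linear_combination hab + hab'
  have hb : 2 * b = - ε * G := by
    refine mul_left_cancel₀ h2 ?_
    linear_combination hab' - hab
  refine ⟨?_, ?_, rfl, ?_, ?_, ?_⟩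
  · field_simp
    linear_combination (-ε) * hb + G * hεε
  · field_simp
    linear_combination hb
  · field_simp
    linear_combination ε * hb - G * hεε
  · field_simp
    linear_combination (-8 * ε) * ha + 8 * G * hεε
  · field_simp
    linear_combination (-8) * ha
end
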